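/- arXiv:math/0508437 — 5 statements merged into one kernel-verified Lean document; each statement's English description precedes it below -/
import Mathlib

section
/- Let S be a symmetric positive definite real R×R matrix and let N be a positive real number. Then for every symmetric positive definite real R×R matrix Σ, −(N/2)·log det Σ − (1/2)·tr(Σ⁻¹ S) ≤ −(N/2)·log det((1/N)·S) − (R·N)/2, with equality if and only if Σ = (1/N)·S. In particular Σ ↦ −(N/2)·log det Σ − (1/2)·tr(Σ⁻¹ S) attains its supremum over positive definite matrices uniquely at Σ = (1/N)·S. -/
open Matrix

namespace Matrix

variable {n : Type*} [Fintype n] [DecidableEq n] {A B : Matrix n n ℝ}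

theorem PosDef.trace_sub_card_sub_log_det (hA : A.PosDef) :
    A.trace - Fintype.card n - Real.log A.det =
      ∑ i, (hA.1.eigenvalues i - 1 - Real.log (hA.1.eigenvalues i)) := by
  have hdet : A.det = ∏ i, hA.1.eigenvalues i := hA.1.det_eq_prod_eigenvalues
  have htr : A.trace = ∑ i, hA.1.eigenvalues i := hA.1.trace_eq_sum_eigenvalues
  rw [hdet, htr, Real.log_prod fun i _ => (hA.eigenvalues_pos i).ne']
  simp [Finset.sum_sub_distrib]

theorem PosDef.log_det_le_trace_sub_card (hA : A.PosDef) :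
    Real.log A.det ≤ A.trace - Fintype.card n := by
  rw [← sub_nonneg, hA.trace_sub_card_sub_log_det]
  exact Finset.sum_nonneg fun i _ =>
    sub_nonneg.2 (Real.log_le_sub_one_of_pos (hA.eigenvalues_pos i))

theorem IsHermitian.eq_one_of_eigenvalues_eq_one (hA : A.IsHermitian)
    (h : ∀ i, hA.eigenvalues i = 1) : A = 1 := by
  have hd : diagonal (RCLike.ofReal ∘ hA.eigenvalues : n → ℝ) = 1 := by
    simp [← diagonal_one, h]
  rw [hA.spectral_theorem, hd, map_one]

theorem PosDef.log_det_eq_trace_sub_card_iff (hA : A.PosDef) :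
    Real.log A.det = A.trace - Fintype.card n ↔ A = 1 := by
  refine ⟨fun h => hA.1.eq_one_of_eigenvalues_eq_one fun i => ?_, fun h => by simp [h]⟩
  have hsum := hA.trace_sub_card_sub_log_det
  rw [h, sub_self, eq_comm, Finset.sum_eq_zero_iff_of_nonneg fun i _ =>
    sub_nonneg.2 (Real.log_le_sub_one_of_pos (hA.eigenvalues_pos i))] at hsum
  by_contra hi
  have := Real.log_lt_sub_one_of_pos (hA.eigenvalues_pos i) hi
  linarith [hsum i (Finset.mem_univ i)]

open scoped MatrixOrder in
theorem PosDef.exists_isUnit_eq_conjTranspose_mul_self (hA : A.PosDef) :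
    ∃ C : Matrix n n ℝ, IsUnit C ∧ A = Cᴴ * C := by
  obtain ⟨C, hC⟩ := CStarAlgebra.nonneg_iff_eq_star_mul_self.mp hA.posSemidef.nonneg
  rw [star_eq_conjTranspose] at hC
  refine ⟨C, ?_, hC⟩
  rw [isUnit_iff_isUnit_det, isUnit_iff_ne_zero]
  intro h
  have := hA.det_pos
  simp [hC, h] at this

/-- A congruence turns `A⁻¹ * B` into a positive definite matrix. -/
theorem PosDef.exists_posDef_trace_det_eq (hA : A.PosDef) (hB : B.PosDef) :
    ∃ M : Matrix n n ℝ, M.PosDef ∧ M.trace = (A⁻¹ * B).trace ∧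
      M.det = B.det / A.det ∧ (M = 1 ↔ A = B) := by
  obtain ⟨C, hC, hAC⟩ := hA.inv.exists_isUnit_eq_conjTranspose_mul_self
  have hCd : IsUnit C.det := (isUnit_iff_isUnit_det C).1 hC
  have hCHd : IsUnit Cᴴ.det := by simpa using hCd
  refine ⟨C * B * Cᴴ, hB.mul_mul_conjTranspose_same (vecMul_injective_of_isUnit hC), ?_, ?_, ?_⟩
  · rw [hAC, trace_mul_comm, mul_assoc]
  · have hdet := congrArg det hAC
    rw [det_mul, det_nonsing_inv, Ring.inverse_eq_inv'] at hdet
    rw [det_mul, det_mul, div_eq_mul_inv, hdet]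
    ring
  · have hAu : IsUnit A.det := (isUnit_iff_isUnit_det A).1 hA.isUnit
    have key : C * B * Cᴴ = 1 ↔ A⁻¹ * B = 1 := by
      rw [hAC, mul_assoc Cᴴ C B, mul_eq_one_comm]
    rw [key]
    constructor
    · intro h
      rw [← mul_one A, ← h, mul_nonsing_inv_cancel_left _ _ hAu]
    · rintro rfl
      exact nonsing_inv_mul _ hAu

theorem PosDef.log_det_sub_log_det_le (hA : A.PosDef) (hB : B.PosDef) :
    Real.log B.det - Real.log A.det ≤ (A⁻¹ * B).trace - Fintype.card n := by
  obtain ⟨M, hM, htr, hdet, -⟩ := hA.exists_posDef_trace_det_eq hB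
  rw [← Real.log_div hB.det_pos.ne' hA.det_pos.ne', ← hdet, ← htr]
  exact hM.log_det_le_trace_sub_card

theorem PosDef.log_det_sub_log_det_eq_iff (hA : A.PosDef) (hB : B.PosDef) :
    Real.log B.det - Real.log A.det = (A⁻¹ * B).trace - Fintype.card n ↔ A = B := by
  obtain ⟨M, hM, htr, hdet, hone⟩ := hA.exists_posDef_trace_det_eq hB
  rw [← Real.log_div hB.det_pos.ne' hA.det_pos.ne', ← hdet, ← htr,
    hM.log_det_eq_trace_sub_card_iff, hone]

end Matrix

/-- For S symmetric positive definite and N > 0, the function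
Σ ↦ −(N/2)·log det Σ − (1/2)·tr(Σ⁻¹ S) on positive definite matrices is maximized
uniquely at Σ = (1/N)·S, with maximal value −(N/2)·log det((1/N)S) − R·N/2. -/
theorem gaussian_sigma_profile_max
    {R : ℕ} (hR : 0 < R) (S : Matrix (Fin R) (Fin R) ℝ) (hS : S.PosDef)
    (N : ℝ) (hN : 0 < N) :
    ∀ Sig : Matrix (Fin R) (Fin R) ℝ, Sig.PosDef →
      (-(N / 2) * Real.log Sig.det - (1 / 2) * (Sig⁻¹ * S).trace
          ≤ -(N / 2) * Real.log ((N⁻¹ • S).det) - (R * N) / 2)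
      ∧ (-(N / 2) * Real.log Sig.det - (1 / 2) * (Sig⁻¹ * S).trace
            = -(N / 2) * Real.log ((N⁻¹ • S).det) - (R * N) / 2
          ↔ Sig = N⁻¹ • S) := by
  intro Sig hSig
  have hT : (N⁻¹ • S).PosDef := hS.smul (inv_pos.2 hN)
  have htr : (Sig⁻¹ * S).trace = N * (Sig⁻¹ * (N⁻¹ • S)).trace := by
    rw [mul_smul_comm, trace_smul, smul_eq_mul, mul_inv_cancel_left₀ hN.ne']
  have hle := hSig.log_det_sub_log_det_le hT
  rw [← hSig.log_det_sub_log_det_eq_iff hT, htr]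
  rw [Fintype.card_fin] at hle ⊢
  refine ⟨by nlinarith, fun h => ?_, fun h => ?_⟩
  · apply mul_left_cancel₀ hN.ne'
    linarith
  · linear_combination (N / 2) * h
end

section
/- Assume the full-rank condition rank [Y;X] = R + C. Regard ℓ as a smooth function on the open set ℝ^{C_R} × {symmetric positive definite R×R matrices} inside ℝ^{C_R} × (symmetric R×R matrices). Then a pair (β,Σ) with Σ symmetric positive definite is a stationary point of ℓ (i.e., the total derivative of ℓ at (β,Σ) is zero) if and only if Σ = (1/N)·S(β) and the gradient of G at β is zero, where G(β) = det S(β). -/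
open Matrix

attribute [local instance] Matrix.normedAddCommGroup Matrix.normedSpace

/-- The coefficient matrix B(β) of the SUR model. -/
def surB {R C : ℕ} (CR : Set (Fin R × Fin C)) [DecidablePred (· ∈ CR)]
    (β : CR → ℝ) : Matrix (Fin R) (Fin C) ℝ :=
  Matrix.of fun r c => if h : (r, c) ∈ CR then β ⟨(r, c), h⟩ else 0

/-- The residual sum-of-squares matrix S(β) = (Y − B(β)X)(Y − B(β)X)ᵀ. -/
def surS {R C N : ℕ} (Y : Matrix (Fin R) (Fin N) ℝ) (X : Matrix (Fin C) (Fin N) ℝ)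
    (CR : Set (Fin R × Fin C)) [DecidablePred (· ∈ CR)]
    (β : CR → ℝ) : Matrix (Fin R) (Fin R) ℝ :=
  (Y - surB CR β * X) * (Y - surB CR β * X)ᵀ

/-- The Gaussian log-likelihood ℓ, as a function on the product space
ℝ^{C_R} × (R×R matrices). -/
noncomputable def surLogLik {R C N : ℕ} (Y : Matrix (Fin R) (Fin N) ℝ)
    (X : Matrix (Fin C) (Fin N) ℝ)
    (CR : Set (Fin R × Fin C)) [DecidablePred (· ∈ CR)]
    (p : (CR → ℝ) × Matrix (Fin R) (Fin R) ℝ) : ℝ :=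
  -(R * N / 2 : ℝ) * Real.log (2 * Real.pi) - (N / 2 : ℝ) * Real.log p.2.det
    - (1 / 2 : ℝ) * (p.2⁻¹ * surS Y X CR p.1).trace

/-- The polynomial objective G(β) = det S(β). -/
def surG {R C N : ℕ} (Y : Matrix (Fin R) (Fin N) ℝ) (X : Matrix (Fin C) (Fin N) ℝ)
    (CR : Set (Fin R × Fin C)) [DecidablePred (· ∈ CR)]
    (β : CR → ℝ) : ℝ :=
  (surS Y X CR β).det

section MatrixCalculus

theorem differentiable_matrix_entry {m k : Type*} [Fintype m] [Fintype k] (i : m) (j : k) :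
    Differentiable ℝ (fun A : Matrix m k ℝ => A i j) := by
  intro A
  exact differentiableAt_pi.1 (differentiableAt_pi.1 (differentiableAt_id (x := A)) i) j

theorem differentiableAt_matrix {E : Type*} [NormedAddCommGroup E] [NormedSpace ℝ E]
    {m k : Type*} [Fintype m] [Fintype k] {f : E → Matrix m k ℝ} {x : E}
    (h : ∀ i j, DifferentiableAt ℝ (fun y => f y i j) x) : DifferentiableAt ℝ f x :=
  differentiableAt_pi.2 fun i => differentiableAt_pi.2 fun j => h i j

theorem DifferentiableAt.matrix_entry {E : Type*} [NormedAddCommGroup E] [NormedSpace ℝ E]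
    {m k : Type*} [Fintype m] [Fintype k] {f : E → Matrix m k ℝ} {x : E}
    (h : DifferentiableAt ℝ f x) (i : m) (j : k) : DifferentiableAt ℝ (fun y => f y i j) x :=
  (differentiable_matrix_entry i j (f x)).comp x h

theorem DifferentiableAt.matrix_mul {E : Type*} [NormedAddCommGroup E] [NormedSpace ℝ E]
    {l m k : Type*} [Fintype l] [Fintype m] [Fintype k]
    {f : E → Matrix l m ℝ} {g : E → Matrix m k ℝ} {x : E}
    (hf : DifferentiableAt ℝ f x) (hg : DifferentiableAt ℝ g x) :
    DifferentiableAt ℝ (fun y => f y * g y) x := by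
  refine differentiableAt_matrix fun i j => ?_
  simp only [Matrix.mul_apply]
  exact DifferentiableAt.fun_sum fun r _ => (hf.matrix_entry i r).mul (hg.matrix_entry r j)

theorem HasDerivAt.matrix_mul {l m k : Type*} [Fintype l] [Fintype m] [Fintype k]
    {f : ℝ → Matrix l m ℝ} {g : ℝ → Matrix m k ℝ} {f' : Matrix l m ℝ} {g' : Matrix m k ℝ} {t : ℝ}
    (hf : HasDerivAt f f' t) (hg : HasDerivAt g g' t) :
    HasDerivAt (fun s => f s * g s) (f' * g t + f t * g') t := by
  refine hasDerivAt_pi.2 fun i => hasDerivAt_pi.2 fun j => ?_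
  simp only [Matrix.mul_apply, Matrix.add_apply, ← Finset.sum_add_distrib]
  exact HasDerivAt.fun_sum fun r _ =>
    (hasDerivAt_pi.1 (hasDerivAt_pi.1 hf i) r).mul (hasDerivAt_pi.1 (hasDerivAt_pi.1 hg r) j)

theorem HasDerivAt.matrix_trace {m : Type*} [Fintype m]
    {f : ℝ → Matrix m m ℝ} {f' : Matrix m m ℝ} {t : ℝ} (hf : HasDerivAt f f' t) :
    HasDerivAt (fun s => (f s).trace) f'.trace t := by
  simp only [Matrix.trace, Matrix.diag]
  exact HasDerivAt.fun_sum fun r _ => hasDerivAt_pi.1 (hasDerivAt_pi.1 hf r) r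

theorem DifferentiableAt.matrix_det {E : Type*} [NormedAddCommGroup E] [NormedSpace ℝ E]
    {m : Type*} [Fintype m] [DecidableEq m] {f : E → Matrix m m ℝ} {x : E}
    (hf : DifferentiableAt ℝ f x) : DifferentiableAt ℝ (fun y => (f y).det) x := by
  simp only [Matrix.det_apply']
  exact DifferentiableAt.fun_sum fun σ _ => (HasFDerivAt.finsetProd
    fun i _ => (hf.matrix_entry (σ i) i).hasFDerivAt).differentiableAt.const_mul _

theorem DifferentiableAt.matrix_inv {E : Type*} [NormedAddCommGroup E] [NormedSpace ℝ E]
    {m : Type*} [Fintype m] [DecidableEq m] {f : E → Matrix m m ℝ} {x : E}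
    (hf : DifferentiableAt ℝ f x) (h0 : (f x).det ≠ 0) :
    DifferentiableAt ℝ (fun y => (f y)⁻¹) x := by
  refine differentiableAt_matrix fun i j => ?_
  simp only [Matrix.inv_def, Matrix.smul_apply, Ring.inverse_eq_inv', smul_eq_mul,
    Matrix.adjugate_apply]
  refine (hf.matrix_det.inv h0).mul (DifferentiableAt.matrix_det ?_)
  refine differentiableAt_matrix fun a b => ?_
  by_cases hab : a = j
  · simp [hab]
  · simpa [Matrix.updateRow_apply, hab] using hf.matrix_entry a b

theorem hasDerivAt_add_smul_matrix {m k : Type*} [Fintype m] [Fintype k] (A H : Matrix m k ℝ) :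
    HasDerivAt (fun t : ℝ => A + t • H) H 0 := by
  refine hasDerivAt_pi.2 fun i => hasDerivAt_pi.2 fun j => ?_
  simpa using ((hasDerivAt_id (0 : ℝ)).mul_const (H i j)).const_add (A i j)

theorem hasDerivAt_det_add_smul {m : Type*} [Fintype m] [DecidableEq m]
    (A H : Matrix m m ℝ) (h0 : A.det ≠ 0) :
    HasDerivAt (fun t : ℝ => (A + t • H).det) (A.det * (A⁻¹ * H).trace) 0 := by
  have h : (fun t : ℝ => (A + t • H).det) = fun t => A.det * (1 + (A⁻¹ * H).trace * t +
      (Matrix.det (1 + (Polynomial.X : Polynomial ℝ) •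
        (A⁻¹ * H).map Polynomial.C)).divX.divX.eval t * t ^ 2) := by
    funext t
    rw [← Matrix.det_one_add_smul, ← Matrix.det_mul, mul_add, mul_one, Matrix.mul_smul,
      Matrix.mul_nonsing_inv_cancel_left _ _ (isUnit_iff_ne_zero.2 h0)]
  rw [h]
  generalize (Matrix.det (1 + (Polynomial.X : Polynomial ℝ) •
        (A⁻¹ * H).map Polynomial.C)).divX.divX = p
  have := ((((hasDerivAt_id (0 : ℝ)).const_mul (A⁻¹ * H).trace).const_add 1).add
    ((p.hasDerivAt 0).mul ((hasDerivAt_id (0 : ℝ)).pow 2))).const_mul A.det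
  simpa using this

theorem HasDerivAt.matrix_det {m : Type*} [Fintype m] [DecidableEq m]
    {f : ℝ → Matrix m m ℝ} {f' : Matrix m m ℝ} {t : ℝ}
    (hf : HasDerivAt f f' t) (h0 : (f t).det ≠ 0) :
    HasDerivAt (fun s => (f s).det) ((f t).det * ((f t)⁻¹ * f').trace) t := by
  have hd : HasFDerivAt (fun A : Matrix m m ℝ => A.det) _ (f t) :=
    (DifferentiableAt.matrix_det (differentiableAt_id (x := f t))).hasFDerivAt
  have hline := hasDerivAt_add_smul_matrix (f t) f'
  have hd' : HasFDerivAt (fun A : Matrix m m ℝ => A.det)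
      (fderiv ℝ (fun A : Matrix m m ℝ => A.det) (f t)) (f t + (0 : ℝ) • f') := by
    rw [zero_smul, add_zero]; exact hd
  have he := (hd'.comp_hasDerivAt (0 : ℝ) hline).unique (hasDerivAt_det_add_smul (f t) f' h0)
  have := hd.comp_hasDerivAt t hf
  exact he ▸ this

theorem HasDerivAt.matrix_inv {m : Type*} [Fintype m] [DecidableEq m]
    {f : ℝ → Matrix m m ℝ} {f' : Matrix m m ℝ} {t : ℝ}
    (hf : HasDerivAt f f' t) (h0 : (f t).det ≠ 0) :
    HasDerivAt (fun s => (f s)⁻¹) (-((f t)⁻¹ * f' * (f t)⁻¹)) t := by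
  have hu := isUnit_iff_ne_zero.2 h0
  obtain ⟨D, hg⟩ : ∃ D, HasDerivAt (fun s => (f s)⁻¹) D t :=
    ⟨_, (hf.differentiableAt.matrix_inv h0).hasDerivAt⟩
  have hev : (fun s => f s * (f s)⁻¹) =ᶠ[nhds t] fun _ => 1 := by
    filter_upwards [(hf.differentiableAt.matrix_det).continuousAt.eventually_ne h0] with s hs
    exact Matrix.mul_nonsing_inv _ (isUnit_iff_ne_zero.2 hs)
  have h := (hf.matrix_mul hg).unique ((hasDerivAt_const t 1).congr_of_eventuallyEq hev)
  have he : -((f t)⁻¹ * f' * (f t)⁻¹) = D := by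
    rw [Matrix.mul_assoc, ← Matrix.mul_neg, ← eq_neg_of_add_eq_zero_right h,
      Matrix.nonsing_inv_mul_cancel_left _ _ hu]
  exact he ▸ hg

end MatrixCalculus

section Model

variable {R C N : ℕ} (Y : Matrix (Fin R) (Fin N) ℝ) (X : Matrix (Fin C) (Fin N) ℝ)
  (CR : Set (Fin R × Fin C)) [DecidablePred (· ∈ CR)]

theorem differentiableAt_surS (β : CR → ℝ) : DifferentiableAt ℝ (surS Y X CR) β := by
  have hB : DifferentiableAt ℝ (surB CR) β := by
    refine differentiableAt_matrix fun r c => ?_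
    by_cases h : (r, c) ∈ CR
    · simpa [surB, h] using differentiableAt_apply (𝕜 := ℝ) (⟨(r, c), h⟩ : CR) β
    · simp [surB, h]
  have hE : DifferentiableAt ℝ (fun b => Y - surB CR b * X) β :=
    (differentiableAt_const Y).sub (hB.matrix_mul (differentiableAt_const X))
  exact hE.matrix_mul (differentiableAt_matrix fun i j => hE.matrix_entry j i)

theorem hasDerivAt_surS_line (β h : CR → ℝ) :
    HasDerivAt (fun t : ℝ => surS Y X CR (β + t • h)) (fderiv ℝ (surS Y X CR) β h) 0 :=
  (differentiableAt_surS Y X CR β).hasFDerivAt.hasLineDerivAt h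

theorem fderiv_surG_apply (β h : CR → ℝ) (h0 : (surS Y X CR β).det ≠ 0) :
    fderiv ℝ (surG Y X CR) β h =
      (surS Y X CR β).det * ((surS Y X CR β)⁻¹ * fderiv ℝ (surS Y X CR) β h).trace := by
  have hG : DifferentiableAt ℝ (surG Y X CR) β := (differentiableAt_surS Y X CR β).matrix_det
  have h1 := (hasDerivAt_surS_line Y X CR β h).matrix_det (by simpa using h0)
  simp only [zero_smul, add_zero] at h1
  exact HasDerivAt.unique (hG.hasFDerivAt.hasLineDerivAt h) h1

theorem fderiv_surLogLik_apply (β h : CR → ℝ) (Sig K : Matrix (Fin R) (Fin R) ℝ)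
    (h0 : Sig.det ≠ 0) :
    fderiv ℝ (surLogLik Y X CR) (β, Sig) (h, K) =
      -(N / 2 : ℝ) * (Sig⁻¹ * K).trace + (1 / 2 : ℝ) *
        (Sig⁻¹ * surS Y X CR β * Sig⁻¹ * K).trace
        - (1 / 2 : ℝ) * (Sig⁻¹ * fderiv ℝ (surS Y X CR) β h).trace := by
  have hfst : DifferentiableAt ℝ (fun p : (CR → ℝ) × Matrix (Fin R) (Fin R) ℝ =>
      surS Y X CR p.1) (β, Sig) :=
    DifferentiableAt.comp (g := surS Y X CR) (β, Sig) (differentiableAt_surS Y X CR β)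
      differentiableAt_fst
  have hsnd : DifferentiableAt ℝ (fun p : (CR → ℝ) × Matrix (Fin R) (Fin R) ℝ => p.2)
      (β, Sig) := differentiableAt_snd
  have hmul := (hsnd.matrix_inv h0).matrix_mul hfst
  have htr : DifferentiableAt ℝ (fun p : (CR → ℝ) × Matrix (Fin R) (Fin R) ℝ =>
      (p.2⁻¹ * surS Y X CR p.1).trace) (β, Sig) := by
    simp only [Matrix.trace, Matrix.diag]
    exact DifferentiableAt.fun_sum fun i _ => hmul.matrix_entry i i
  have hL : DifferentiableAt ℝ (surLogLik Y X CR) (β, Sig) :=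
    ((differentiableAt_const _).sub ((hsnd.matrix_det.log h0).const_mul _)).sub
      (htr.const_mul _)
  have hS := hasDerivAt_surS_line Y X CR β h
  have hK := hasDerivAt_add_smul_matrix Sig K
  have h0' : (Sig + (0 : ℝ) • K).det ≠ 0 := by simpa using h0
  have hl := (((hasDerivAt_const (0 : ℝ) (-(R * N / 2 : ℝ) * Real.log (2 * Real.pi))).sub
    (((hK.matrix_det h0').log h0').const_mul (N / 2 : ℝ))).sub
    ((((hK.matrix_inv h0').matrix_mul hS).matrix_trace).const_mul (1 / 2 : ℝ)))
  refine (HasDerivAt.unique (hL.hasFDerivAt.hasLineDerivAt (h, K)) hl).trans ?_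
  have hc : (Sig⁻¹ * K * Sig⁻¹ * surS Y X CR β).trace
      = (Sig⁻¹ * surS Y X CR β * Sig⁻¹ * K).trace := by
    rw [Matrix.mul_assoc (Sig⁻¹ * K), Matrix.trace_mul_comm, ← Matrix.mul_assoc]
  simp only [zero_smul, add_zero, Matrix.neg_mul, Matrix.trace_add, Matrix.trace_neg, hc]
  field_simp
  ring

end Model

/-- Under the full-rank condition, (β,Σ) with Σ positive definite is a
stationary point of ℓ iff Σ = (1/N)·S(β) and the gradient of G at β vanishes. -/
theorem sur_stationary_iff
    {R C N : ℕ} (hR : 0 < R) (hC : 0 < C) (hN : 0 < N)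
    (Y : Matrix (Fin R) (Fin N) ℝ) (X : Matrix (Fin C) (Fin N) ℝ)
    (hrank : (Matrix.fromRows Y X).rank = R + C)
    (CR : Set (Fin R × Fin C)) [DecidablePred (· ∈ CR)] :
    ∀ (β : CR → ℝ) (Sig : Matrix (Fin R) (Fin R) ℝ), Sig.PosDef →
      (fderiv ℝ (surLogLik Y X CR) (β, Sig) = 0
        ↔ (Sig = (N : ℝ)⁻¹ • surS Y X CR β ∧ fderiv ℝ (surG Y X CR) β = 0)) := by
  intro β Sig hpos
  have h0 : Sig.det ≠ 0 := hpos.det_pos.ne'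
  have hu := isUnit_iff_ne_zero.2 h0
  have hN0 : (N : ℝ) ≠ 0 := by positivity
  have key := fun h K => fderiv_surLogLik_apply Y X CR β h Sig K h0
  have hdet : Sig = (N : ℝ)⁻¹ • surS Y X CR β → (surS Y X CR β).det ≠ 0 := by
    intro hS hz
    exact h0 (by rw [hS, Matrix.det_smul, hz, mul_zero])
  have hinv : Sig = (N : ℝ)⁻¹ • surS Y X CR β →
      Sig⁻¹ = (N : ℝ) • (surS Y X CR β)⁻¹ := by
    intro hS
    refine Matrix.inv_eq_right_inv ?_
    conv_lhs => rw [hS]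
    rw [Matrix.smul_mul, Matrix.mul_smul, smul_smul, inv_mul_cancel₀ hN0, one_smul,
      Matrix.mul_nonsing_inv _ (isUnit_iff_ne_zero.2 (hdet hS))]
  constructor
  · intro hf
    have hS : Sig = (N : ℝ)⁻¹ • surS Y X CR β := by
      have hM : Sig⁻¹ * surS Y X CR β * Sig⁻¹ = (N : ℝ) • Sig⁻¹ := by
        refine Matrix.ext_iff_trace_mul_right.2 fun K => ?_
        have := key 0 K
        rw [hf] at this
        simp only [_root_.zero_apply, map_zero, Matrix.mul_zero,
          Matrix.trace_zero] at this
        rw [Matrix.smul_mul, Matrix.trace_smul, smul_eq_mul]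
        linarith
      have h2 := congrArg (fun M => Sig * M * Sig) hM
      simp only [Matrix.mul_smul, Matrix.smul_mul, Matrix.mul_nonsing_inv _ hu,
        Matrix.one_mul] at h2
      rw [Matrix.mul_assoc Sig⁻¹, Matrix.mul_nonsing_inv_cancel_left _ _ hu,
        Matrix.nonsing_inv_mul_cancel_right _ _ hu] at h2
      rw [h2, smul_smul, inv_mul_cancel₀ hN0, one_smul]
    refine ⟨hS, ContinuousLinearMap.ext fun h => ?_⟩
    have hk := key h 0
    rw [hf, hinv hS] at hk
    simp only [_root_.zero_apply, Matrix.mul_zero, Matrix.trace_zero,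
      Matrix.smul_mul, Matrix.trace_smul, smul_eq_mul] at hk
    have hz : ((surS Y X CR β)⁻¹ * fderiv ℝ (surS Y X CR) β h).trace = 0 := by
      refine (mul_eq_zero.1 ?_).resolve_left hN0
      linarith
    rw [fderiv_surG_apply Y X CR β h (hdet hS), hz, mul_zero, _root_.zero_apply]
  · rintro ⟨hS, hG⟩
    refine ContinuousLinearMap.ext fun p => ?_
    have hz : ((surS Y X CR β)⁻¹ * fderiv ℝ (surS Y X CR) β p.1).trace = 0 := by
      have := fderiv_surG_apply Y X CR β p.1 (hdet hS)
      rw [hG, _root_.zero_apply] at this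
      exact (mul_eq_zero.1 this.symm).resolve_left (hdet hS)
    have hM : Sig⁻¹ * surS Y X CR β * Sig⁻¹ = (N : ℝ) • Sig⁻¹ := by
      have hSN : surS Y X CR β = (N : ℝ) • Sig := by
        rw [hS, smul_smul, mul_inv_cancel₀ hN0, one_smul]
      rw [hSN, Matrix.mul_smul, Matrix.nonsing_inv_mul _ hu, Matrix.smul_mul, Matrix.one_mul]
    rw [← Prod.mk.eta (p := p), key p.1 p.2, hM, _root_.zero_apply]
    have hz' : (Sig⁻¹ * fderiv ℝ (surS Y X CR) β p.1).trace = 0 := by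
      rw [hinv hS, Matrix.smul_mul, Matrix.trace_smul, hz, smul_zero]
    rw [hz', Matrix.smul_mul, Matrix.trace_smul, smul_eq_mul]
    ring
end

section
/- Assume the full-rank condition rank [Y;X] = R + C (which implies X has rank C). With A, vec, and the Kronecker product ⊗ as defined in the context, a pair (β,Σ) with Σ symmetric positive definite solves the likelihood equations (i.e., the total derivative of ℓ at (β,Σ) is zero) if and only if Σ = (1/N)·(Y − B(β)X)(Y − B(β)X)ᵀ and β = [Aᵀ((XXᵀ) ⊗ Σ⁻¹)A]⁻¹ Aᵀ vec(Σ⁻¹ Y Xᵀ). -/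
open Matrix Kronecker

attribute [local instance] Matrix.normedAddCommGroup Matrix.normedSpace

/-- vec stacks a matrix into a vector indexed by (column, row) pairs. -/
def vecM {R C : ℕ} (M : Matrix (Fin R) (Fin C) ℝ) : Fin C × Fin R → ℝ :=
  fun p => M p.2 p.1

/-- The zero-one matrix A with vec(B(β)) = Aβ, each column a distinct standard basis
vector. -/
def surA {R C : ℕ} (CR : Set (Fin R × Fin C)) [DecidablePred (· ∈ CR)] :
    Matrix (Fin C × Fin R) CR ℝ :=
  Matrix.of fun p q => if p.1 = q.1.2 ∧ p.2 = q.1.1 then 1 else 0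

namespace Matrix

theorem hasDerivAt_log_det_add_smul {n : Type*} [Fintype n] [DecidableEq n]
    {M : Matrix n n ℝ} (hM : IsUnit M.det) (H : Matrix n n ℝ) :
    HasDerivAt (fun t : ℝ => Real.log (M + t • H).det) (M⁻¹ * H).trace 0 := by
  have hpoly : (fun t : ℝ => (M + t • H).det) = fun t =>
      M.det * (det (1 + (Polynomial.X : Polynomial ℝ) • (M⁻¹ * H).map Polynomial.C)).eval t := by
    funext t
    rw [← Polynomial.coe_evalRingHom, RingHom.map_det, ← det_mul]
    congr 1
    have : (Polynomial.evalRingHom t).mapMatrix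
        (1 + (Polynomial.X : Polynomial ℝ) • (M⁻¹ * H).map Polynomial.C) =
        1 + t • (M⁻¹ * H) := by
      ext i j
      simp [-Matrix.map_mul, Matrix.one_apply, apply_ite, mul_comm t]
    rw [this, Matrix.mul_add, Matrix.mul_one, Matrix.mul_smul, ← Matrix.mul_assoc,
      Matrix.mul_nonsing_inv _ hM, Matrix.one_mul]
  have hdet : HasDerivAt (fun t : ℝ => (M + t • H).det) (M.det * (M⁻¹ * H).trace) 0 := by
    rw [hpoly, ← derivative_det_one_add_X_smul (M⁻¹ * H)]
    exact (Polynomial.hasDerivAt _ _).const_mul _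
  convert! hdet.log (by simpa using hM.ne_zero) using 1
  simp [hM.ne_zero]

theorem differentiable_apply {m n : Type*} [Fintype m] [Fintype n] (i : m) (j : n) :
    Differentiable ℝ (fun A : Matrix m n ℝ => A i j) :=
  ((LinearMap.toContinuousLinearMap (entryLinearMap ℝ ℝ i j)).differentiable :)

theorem differentiable_det {n : Type*} [Fintype n] [DecidableEq n] :
    Differentiable ℝ (fun A : Matrix n n ℝ => A.det) := by
  have hentry (i j : n) := differentiable_apply (m := n) (n := n) i j
  simp only [det_apply']
  fun_prop

theorem differentiableAt_inv {n : Type*} [Fintype n] [DecidableEq n]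
    {M : Matrix n n ℝ} (hM : IsUnit M.det) :
    DifferentiableAt ℝ (fun A : Matrix n n ℝ => A⁻¹) M := by
  refine differentiableAt_pi.2 fun i => differentiableAt_pi.2 fun j => ?_
  have hrow : Differentiable ℝ (fun A : Matrix n n ℝ => A.updateRow j (Pi.single i 1)) := by
    refine differentiable_pi.2 fun k => differentiable_pi.2 fun l => ?_
    by_cases h : k = j
    · simp [h]
    · simp only [updateRow_ne h]
      exact differentiable_apply k l
  have hadj : Differentiable ℝ (fun A : Matrix n n ℝ => A.adjugate i j) := by
    simp only [adjugate_apply]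
    exact differentiable_det.comp hrow
  simp only [inv_def, Ring.inverse_eq_inv', smul_apply, smul_eq_mul]
  exact (differentiable_det.differentiableAt.inv hM.ne_zero).mul hadj.differentiableAt

theorem hasDerivAt_inv_add_smul {n : Type*} [Fintype n] [DecidableEq n]
    {M : Matrix n n ℝ} (hM : IsUnit M.det) (H : Matrix n n ℝ) :
    HasDerivAt (fun t : ℝ => (M + t • H)⁻¹) (-(M⁻¹ * H * M⁻¹)) 0 := by
  have hline : ContinuousAt (fun t : ℝ => M + t • H) 0 := by fun_prop
  have hcont : ContinuousAt (fun t : ℝ => (M + t • H)⁻¹) 0 :=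
    ContinuousAt.comp (g := fun A : Matrix n n ℝ => A⁻¹) (f := fun t : ℝ => M + t • H)
      (by simpa using (differentiableAt_inv hM).continuousAt) hline
  have hdet : ∀ᶠ t : ℝ in nhds 0, IsUnit (M + t • H).det := by
    have h : ContinuousAt (fun t : ℝ => (M + t • H).det) 0 :=
      ContinuousAt.comp (g := fun A : Matrix n n ℝ => A.det) (f := fun t : ℝ => M + t • H)
        differentiable_det.continuous.continuousAt hline
    simp only [isUnit_iff_ne_zero]
    exact h.eventually_ne (by simpa using hM.ne_zero)
  have hlim : Filter.Tendsto (fun t : ℝ => -((M + t • H)⁻¹ * H * M⁻¹)) (nhds 0)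
      (nhds (-(M⁻¹ * H * M⁻¹))) := by
    have h : ContinuousAt (fun t : ℝ => -((M + t • H)⁻¹ * H * M⁻¹)) 0 :=
      ContinuousAt.comp (g := fun A : Matrix n n ℝ => -(A * H * M⁻¹))
        (f := fun t : ℝ => (M + t • H)⁻¹) (by fun_prop) hcont
    simpa [ContinuousAt] using h
  refine hasDerivAt_iff_tendsto_slope_zero.2 ((hlim.mono_left nhdsWithin_le_nhds).congr' ?_)
  filter_upwards [hdet.filter_mono nhdsWithin_le_nhds, self_mem_nhdsWithin] with t ht ht0
  have ht0' : t ≠ 0 := ht0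
  have hunit : IsUnit (M + t • H) ↔ IsUnit M := by
    simp only [isUnit_iff_isUnit_det, ht, hM]
  rw [zero_add, zero_smul, add_zero, Matrix.inv_sub_inv hunit, sub_add_cancel_left]
  simp [ht0']

theorem posDef_mul_transpose_of_rank_fromRows {R C N : ℕ} {Y : Matrix (Fin R) (Fin N) ℝ}
    {X : Matrix (Fin C) (Fin N) ℝ} (h : (fromRows Y X).rank = R + C) : (X * Xᵀ).PosDef := by
  have hli : LinearIndependent ℝ (fromRows Y X).row := by
    rw [linearIndependent_iff_card_eq_finrank_span, Set.finrank, ← rank_eq_finrank_span_row, h]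
    simp
  have hX : LinearIndependent ℝ X.row := hli.comp Sum.inr Sum.inr_injective
  rw [← conjTranspose_eq_transpose_of_trivial]
  exact PosDef.mul_conjTranspose_self _ (vecMul_injective_iff.2 hX)

theorem eq_zero_of_forall_trace_mul_eq_zero {m n : Type*} [Fintype m] [Fintype n]
    {G : Matrix m n ℝ} (h : ∀ H : Matrix n m ℝ, (G * H).trace = 0) : G = 0 := by
  have := h Gᴴ
  rwa [trace_mul_conjTranspose_self_eq_zero_iff] at this

end Matrix

section

variable {R C N : ℕ} (Y : Matrix (Fin R) (Fin N) ℝ) (X : Matrix (Fin C) (Fin N) ℝ)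
  (CR : Set (Fin R × Fin C)) [DecidablePred (· ∈ CR)]

theorem vecM_eq_vec (M : Matrix (Fin R) (Fin C) ℝ) : vecM M = M.vec := rfl

theorem surB_add_smul (β b : CR → ℝ) (t : ℝ) :
    surB CR (β + t • b) = surB CR β + t • surB CR b := by
  ext r c
  by_cases h : (r, c) ∈ CR <;> simp [surB, h]

theorem surA_mulVec (β : CR → ℝ) : surA CR *ᵥ β = (surB CR β).vec := by
  ext ⟨c, r⟩
  simp only [surA, mulVec, dotProduct, of_apply, ite_mul, one_mul, zero_mul, vec, surB]
  split_ifs with h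
  · rw [Finset.sum_eq_single ⟨(r, c), h⟩] <;> simp
    grind
  · refine Finset.sum_eq_zero fun q _ => if_neg ?_
    rintro ⟨rfl, rfl⟩
    exact h q.2

theorem surA_mulVec_injective : Function.Injective (surA CR).mulVec := by
  intro β b h
  rw [surA_mulVec, surA_mulVec, vec_inj] at h
  ext ⟨⟨r, c⟩, hq⟩
  simpa [surB, hq] using congrFun (congrFun h r) c

theorem surA_transpose_mulVec_eq_zero_iff (G : Matrix (Fin R) (Fin C) ℝ) :
    (surA CR)ᵀ *ᵥ G.vec = 0 ↔ ∀ b : CR → ℝ, ((surB CR b)ᵀ * G).trace = 0 := by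
  have key (b : CR → ℝ) : ((surB CR b)ᵀ * G).trace = b ⬝ᵥ (surA CR)ᵀ *ᵥ G.vec := by
    rw [← vec_dotProduct_vec, ← surA_mulVec, dotProduct_mulVec, vecMul_transpose]
  simp only [key]
  refine ⟨fun h b => by simp [h], fun h => dotProduct_self_eq_zero.1 (h _)⟩

theorem differentiableAt_surLogLik (β : CR → ℝ) {Sig : Matrix (Fin R) (Fin R) ℝ}
    (hSig : Sig.PosDef) : DifferentiableAt ℝ (surLogLik Y X CR) (β, Sig) := by
  have hu : IsUnit Sig.det := (isUnit_iff_isUnit_det Sig).1 hSig.isUnit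
  have hdet : DifferentiableAt ℝ
      (fun p : (CR → ℝ) × Matrix (Fin R) (Fin R) ℝ => p.2.det) (β, Sig) :=
    Matrix.differentiable_det.differentiableAt.comp (β, Sig) differentiableAt_snd
  have hinv : DifferentiableAt ℝ
      (fun p : (CR → ℝ) × Matrix (Fin R) (Fin R) ℝ => p.2⁻¹) (β, Sig) :=
    (Matrix.differentiableAt_inv hu).comp (β, Sig) differentiableAt_snd
  have hinv_apply (i j : Fin R) : DifferentiableAt ℝ
      (fun p : (CR → ℝ) × Matrix (Fin R) (Fin R) ℝ => p.2⁻¹ i j) (β, Sig) :=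
    differentiableAt_pi.1 (differentiableAt_pi.1 hinv i) j
  have hB (i : Fin R) (j : Fin C) : DifferentiableAt ℝ
      (fun p : (CR → ℝ) × Matrix (Fin R) (Fin R) ℝ => surB CR p.1 i j) (β, Sig) := by
    by_cases h : (i, j) ∈ CR
    · simp only [surB, of_apply, h, dite_true]
      fun_prop
    · simp [surB, h]
  have hlog := hdet.log hu.ne_zero
  have htrace : DifferentiableAt ℝ (fun p : (CR → ℝ) × Matrix (Fin R) (Fin R) ℝ =>
      (p.2⁻¹ * surS Y X CR p.1).trace) (β, Sig) := by
    simp only [surS, trace, diag, mul_apply, transpose_apply, Matrix.sub_apply]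
    have hE (i : Fin R) (k : Fin N) : DifferentiableAt ℝ
        (fun p : (CR → ℝ) × Matrix (Fin R) (Fin R) ℝ =>
          Y i k - ∑ j, surB CR p.1 i j * X j k) (β, Sig) :=
      (DifferentiableAt.fun_sum fun j _ => (hB i j).mul_const _).const_sub _
    exact DifferentiableAt.fun_sum fun i _ => DifferentiableAt.fun_sum fun j _ =>
      (hinv_apply i j).mul (DifferentiableAt.fun_sum fun k _ => (hE j k).mul (hE i k))
  exact ((hlog.const_mul _).const_sub _).sub (htrace.const_mul _)

theorem trace_surS_add_smul {P : Matrix (Fin R) (Fin R) ℝ} (hP : Pᵀ = P) (β b : CR → ℝ) (t : ℝ) :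
    (P * surS Y X CR (β + t • b)).trace = (P * surS Y X CR β).trace
      - 2 * t * ((surB CR b)ᵀ * (P * (Y - surB CR β * X) * Xᵀ)).trace
      + t ^ 2 * (P * (surB CR b * X * (surB CR b * X)ᵀ)).trace := by
  set E := Y - surB CR β * X with hE
  have h1 : (P * (E * (surB CR b * X)ᵀ)).trace = ((surB CR b)ᵀ * (P * E * Xᵀ)).trace := by
    rw [trace_mul_comm (surB CR b)ᵀ, transpose_mul]
    simp only [Matrix.mul_assoc]
  have h2 : (P * (surB CR b * X * Eᵀ)).trace = ((surB CR b)ᵀ * (P * E * Xᵀ)).trace := by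
    rw [← h1, ← trace_transpose, transpose_mul, transpose_mul, transpose_transpose, hP,
      trace_mul_comm]
  have h3 : Y - surB CR (β + t • b) * X = E - t • (surB CR b * X) := by
    rw [surB_add_smul, Matrix.add_mul, Matrix.smul_mul, hE, sub_add_eq_sub_sub]
  rw [surS, surS, h3, ← hE]
  simp only [transpose_sub, transpose_smul, Matrix.sub_mul, Matrix.mul_sub, Matrix.smul_mul,
    Matrix.mul_smul, trace_sub, trace_smul, h1, h2, smul_eq_mul]
  ring

theorem fderiv_surLogLik_inl (β b : CR → ℝ) {Sig : Matrix (Fin R) (Fin R) ℝ}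
    (hSig : Sig.PosDef) : fderiv ℝ (surLogLik Y X CR) (β, Sig) (b, 0) =
      ((surB CR b)ᵀ * (Sig⁻¹ * (Y - surB CR β * X) * Xᵀ)).trace := by
  have hP : (Sig⁻¹)ᵀ = Sig⁻¹ := by
    simpa [IsHermitian, conjTranspose_eq_transpose_of_trivial] using hSig.inv.isHermitian
  refine ((differentiableAt_surLogLik Y X CR β hSig).hasFDerivAt.hasLineDerivAt
    (b, 0)).unique ?_
  rw [HasLineDerivAt]
  simp only [surLogLik, Prod.smul_mk, smul_zero, Prod.mk_add_mk, add_zero,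
    trace_surS_add_smul Y X CR hP]
  generalize ((surB CR b)ᵀ * (Sig⁻¹ * (Y - surB CR β * X) * Xᵀ)).trace = u
  generalize (Sig⁻¹ * (surB CR b * X * (surB CR b * X)ᵀ)).trace = v
  have h1 : HasDerivAt (fun t : ℝ => t) 1 0 := hasDerivAt_id 0
  convert! (((((h1.const_mul 2).mul_const u).const_sub _).add
    ((h1.pow 2).mul_const v)).const_mul (1 / 2 : ℝ)).const_sub _ using 1
  simp

theorem fderiv_surLogLik_inr (β : CR → ℝ) {Sig : Matrix (Fin R) (Fin R) ℝ}
    (hSig : Sig.PosDef) (H : Matrix (Fin R) (Fin R) ℝ) :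
    fderiv ℝ (surLogLik Y X CR) (β, Sig) (0, H) =
      (1 / 2 : ℝ) *
        ((Sig⁻¹ * surS Y X CR β * Sig⁻¹ - (N : ℝ) • Sig⁻¹) * H).trace := by
  have hu : IsUnit Sig.det := (isUnit_iff_isUnit_det Sig).1 hSig.isUnit
  refine ((differentiableAt_surLogLik Y X CR β hSig).hasFDerivAt.hasLineDerivAt
    (0, H)).unique ?_
  rw [HasLineDerivAt]
  simp only [surLogLik, Prod.smul_mk, smul_zero, Prod.mk_add_mk, add_zero]
  let T : Matrix (Fin R) (Fin R) ℝ →L[ℝ] ℝ := LinearMap.toContinuousLinearMap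
    (traceLinearMap (Fin R) ℝ ℝ ∘ₗ LinearMap.mulRight ℝ (surS Y X CR β))
  have htrace : HasDerivAt (fun t : ℝ => ((Sig + t • H)⁻¹ * surS Y X CR β).trace)
      (-(Sig⁻¹ * H * Sig⁻¹) * surS Y X CR β).trace 0 := T.hasFDerivAt.comp_hasDerivAt 0
        (hasDerivAt_inv_add_smul hu H)
  convert! (((hasDerivAt_log_det_add_smul hu H).const_mul (N / 2 : ℝ)).const_sub _).sub
    (htrace.const_mul (1 / 2 : ℝ)) using 1
  have hcyc : (Sig⁻¹ * H * Sig⁻¹ * surS Y X CR β).trace =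
      (Sig⁻¹ * surS Y X CR β * Sig⁻¹ * H).trace := by
    rw [Matrix.mul_assoc, trace_mul_comm, ← Matrix.mul_assoc]
  simp only [Matrix.neg_mul, trace_neg, hcyc, Matrix.sub_mul, Matrix.smul_mul, trace_sub,
    trace_smul, smul_eq_mul]
  ring

theorem surLogLik_score_coeff_eq_zero_iff (hX : (X * Xᵀ).PosDef) (β : CR → ℝ)
    {Sig : Matrix (Fin R) (Fin R) ℝ} (hSig : Sig.PosDef) :
    (surA CR)ᵀ *ᵥ (Sig⁻¹ * (Y - surB CR β * X) * Xᵀ).vec = 0 ↔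
      β = ((surA CR)ᵀ * ((X * Xᵀ) ⊗ₖ Sig⁻¹) * surA CR)⁻¹ *ᵥ
        ((surA CR)ᵀ *ᵥ vecM (Sig⁻¹ * Y * Xᵀ)) := by
  set M := (surA CR)ᵀ * ((X * Xᵀ) ⊗ₖ Sig⁻¹) * surA CR with hMdef
  have hM : M.PosDef := by
    rw [hMdef, ← conjTranspose_eq_transpose_of_trivial (surA CR)]
    exact (hX.kronecker hSig.inv).conjTranspose_mul_mul_same (surA_mulVec_injective CR)
  have hu : IsUnit M.det := (isUnit_iff_isUnit_det M).1 hM.isUnit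
  have hMβ : M *ᵥ β = (surA CR)ᵀ *ᵥ (Sig⁻¹ * (surB CR β * X) * Xᵀ).vec := by
    rw [hMdef, ← mulVec_mulVec, ← mulVec_mulVec, surA_mulVec, kronecker_mulVec_vec,
      transpose_mul, transpose_transpose]
    simp only [Matrix.mul_assoc]
  rw [Matrix.mul_sub, Matrix.sub_mul, vec_sub, mulVec_sub, ← hMβ, sub_eq_zero, vecM_eq_vec]
  constructor
  · intro h
    rw [h, mulVec_mulVec, nonsing_inv_mul _ hu, one_mulVec]
  · intro h
    conv_rhs => rw [h]
    rw [mulVec_mulVec, mul_nonsing_inv _ hu, one_mulVec]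

theorem surLogLik_score_cov_eq_zero_iff (hN : 0 < N) (β : CR → ℝ)
    {Sig : Matrix (Fin R) (Fin R) ℝ} (hSig : Sig.PosDef) :
    Sig⁻¹ * surS Y X CR β * Sig⁻¹ - (N : ℝ) • Sig⁻¹ = 0 ↔
      Sig = (N : ℝ)⁻¹ • surS Y X CR β := by
  have hu : IsUnit Sig.det := (isUnit_iff_isUnit_det Sig).1 hSig.isUnit
  have hN' : (N : ℝ) ≠ 0 := by positivity
  rw [sub_eq_zero, eq_inv_smul_iff₀ hN']
  constructor
  · intro h
    have h2 := congrArg (fun G => Sig * G * Sig) h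
    simpa [Matrix.mul_assoc, nonsing_inv_mul _ hu, mul_nonsing_inv_cancel_left _ _ hu]
      using h2.symm
  · intro h
    rw [← h]
    simp [Matrix.mul_assoc, mul_nonsing_inv _ hu]

end

/-- Under the full-rank condition, (β,Σ) with Σ positive definite solves
the likelihood equations iff Σ = (1/N)·(Y−B(β)X)(Y−B(β)X)ᵀ and
β = [Aᵀ((XXᵀ)⊗Σ⁻¹)A]⁻¹ Aᵀ vec(Σ⁻¹YXᵀ). -/
theorem sur_likelihood_equations
    {R C N : ℕ} (hR : 0 < R) (hC : 0 < C) (hN : 0 < N)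
    (Y : Matrix (Fin R) (Fin N) ℝ) (X : Matrix (Fin C) (Fin N) ℝ)
    (hrank : (Matrix.fromRows Y X).rank = R + C)
    (CR : Set (Fin R × Fin C)) [DecidablePred (· ∈ CR)] :
    ∀ (β : CR → ℝ) (Sig : Matrix (Fin R) (Fin R) ℝ), Sig.PosDef →
      (fderiv ℝ (surLogLik Y X CR) (β, Sig) = 0
        ↔ (Sig = (N : ℝ)⁻¹ • surS Y X CR β
            ∧ β = ((surA CR)ᵀ * ((X * Xᵀ) ⊗ₖ Sig⁻¹) * surA CR)⁻¹.mulVec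
                ((surA CR)ᵀ.mulVec (vecM (Sig⁻¹ * Y * Xᵀ))))) := by
  intro β Sig hSig
  rw [← surLogLik_score_cov_eq_zero_iff Y X CR hN β hSig,
    ← surLogLik_score_coeff_eq_zero_iff Y X CR
      (posDef_mul_transpose_of_rank_fromRows hrank) β hSig,
    surA_transpose_mulVec_eq_zero_iff]
  constructor
  · intro h
    refine ⟨eq_zero_of_forall_trace_mul_eq_zero fun H => ?_, fun b => ?_⟩
    · simpa [h] using (fderiv_surLogLik_inr Y X CR β hSig H).symm
    · rw [← fderiv_surLogLik_inl Y X CR β b hSig, h]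
      rfl
  · rintro ⟨hcov, hcoeff⟩
    refine ContinuousLinearMap.ext fun v => ?_
    have hv : v = (v.1, 0) + (0, v.2) := by simp
    rw [hv, map_add, fderiv_surLogLik_inl Y X CR β v.1 hSig,
      fderiv_surLogLik_inr Y X CR β hSig v.2, hcov, hcoeff]
    simp
end

section
/- Let X = [[188,22,−46,77,−103,74,83,101],[55,−216,116,−30,131,195,−311,−239]] and Y = [[234,−5,6,182,−193,278,62,−68],[497,−326,266,−3,93,558,−584,−224]] be the given integer 2×8 matrices, and for (β₁,β₂) ∈ ℂ² let B(β₁,β₂) = [[β₁,0],[0,β₂]] and G(β₁,β₂) = det((Y − B(β₁,β₂)X)(Y − B(β₁,β₂)X)ᵀ), a polynomial in β₁, β₂. Then the system of equations ∂G/∂β₁ = 0, ∂G/∂β₂ = 0 has exactly five solutions in ℂ², and exactly three of these solutions lie in ℝ². Consequently, the likelihood function of the seemingly unrelated regressions model with C_R = {(1,1),(2,2)} for these data has exactly three stationary points. -/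
open Matrix MvPolynomial

attribute [local instance] Matrix.normedAddCommGroup Matrix.normedSpace

/-- The covariate data X of Drton (2004, Table 1), as a matrix of constant polynomials. -/
noncomputable def drtonXp : Matrix (Fin 2) (Fin 8) (MvPolynomial (Fin 2) ℂ) :=
  !![188, 22, -46, 77, -103, 74, 83, 101;
     55, -216, 116, -30, 131, 195, -311, -239]

/-- The response data Y of Drton (2004, Table 1), as a matrix of constant polynomials. -/
noncomputable def drtonYp : Matrix (Fin 2) (Fin 8) (MvPolynomial (Fin 2) ℂ) :=
  !![234, -5, 6, 182, -193, 278, 62, -68;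
     497, -326, 266, -3, 93, 558, -584, -224]

/-- The diagonal coefficient matrix B(β₁,β₂) = [[β₁,0],[0,β₂]] in polynomial variables. -/
noncomputable def drtonBp : Matrix (Fin 2) (Fin 2) (MvPolynomial (Fin 2) ℂ) :=
  !![X 0, 0; 0, X 1]

/-- The polynomial G(β₁,β₂) = det((Y − B(β₁,β₂)X)(Y − B(β₁,β₂)X)ᵀ) with
B(β₁,β₂) = [[β₁,0],[0,β₂]]. -/
noncomputable def drtonG : MvPolynomial (Fin 2) ℂ :=
  ((drtonYp - drtonBp * drtonXp) * (drtonYp - drtonBp * drtonXp)ᵀ).det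

/-- The set of complex solutions of the critical equations ∂G/∂β₁ = ∂G/∂β₂ = 0. -/
noncomputable def drtonCrit : Set (Fin 2 → ℂ) :=
  {z | eval z (pderiv 0 drtonG) = 0 ∧ eval z (pderiv 1 drtonG) = 0}

/-- The real data matrices. -/
noncomputable def drtonXr : Matrix (Fin 2) (Fin 8) ℝ :=
  !![188, 22, -46, 77, -103, 74, 83, 101;
     55, -216, 116, -30, 131, 195, -311, -239]

noncomputable def drtonYr : Matrix (Fin 2) (Fin 8) ℝ :=
  !![234, -5, 6, 182, -193, 278, 62, -68;
     497, -326, 266, -3, 93, 558, -584, -224]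

/-- The log-likelihood of the SUR model with C_R = {(1,1),(2,2)} (diagonal B) for the
Drton data, as a function on (β₁,β₂) × (2×2 matrices); here R = 2 and N = 8. -/
noncomputable def drtonLogLik (p : (Fin 2 → ℝ) × Matrix (Fin 2) (Fin 2) ℝ) : ℝ :=
  -(2 * 8 / 2 : ℝ) * Real.log (2 * Real.pi) - (8 / 2 : ℝ) * Real.log p.2.det
    - (1 / 2 : ℝ) * (p.2⁻¹ * ((drtonYr - !![p.1 0, 0; 0, p.1 1] * drtonXr) *
        (drtonYr - !![p.1 0, 0; 0, p.1 1] * drtonXr)ᵀ)).trace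

theorem drtonG_eq : drtonG =
    (C 77048 * X 0 ^ 2 - C 192698 * X 0 + C 210942) *
      (C 273065 * X 1 ^ 2 - C 969700 * X 1 + C 1135295) -
    (C 235177 - C 34414 * X 0 - C 35083 * X 1 - C 51073 * (X 0 * X 1)) ^ 2 := by
  simp only [drtonG, Matrix.det_fin_two, Matrix.mul_apply, Fin.sum_univ_eight, Fin.sum_univ_two,
    Matrix.transpose_apply, Matrix.sub_apply, drtonXp, drtonYp, drtonBp]
  simp 
  simp only [map_ofNat]
  ring

theorem mem_drtonCrit (z : Fin 2 → ℂ) : z ∈ drtonCrit ↔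
    (18430660791 * z 1 ^ 2 - 78228698044 * z 1 + 86287885764) * z 0 +
      (-28101333744 * z 1 ^ 2 + 104233473859 * z 1 - 101291156677) = 0 ∧
    (18430660791 * z 1 - 39114349022) * z 0 ^ 2 +
      (-56202667488 * z 1 + 104233473859) * z 0 + (56370060341 * z 1 - 94024514009) = 0 := by
  have h : ∀ a b : ℂ, a = 2 * b → (a = 0 ↔ b = 0) := by
    rintro a b rfl; simp
  simp only [drtonCrit, Set.mem_ofPred_eq, drtonG_eq]
  refine and_congr (h _ _ ?_) (h _ _ ?_) <;>
  · simp [Derivation.leibniz, pderiv_X, Derivation.leibniz_pow]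
    ring

/-- The quintic satisfied by the second coordinate of every critical point of `drtonG`. -/
def drtonQuintic {K : Type*} [Field K] (x : K) : K :=
  918777665793553181376677373249 * x ^ 5 - 9567857224000144024273044854829 * x ^ 4 +
    40167094888463786054331112336432 * x ^ 3 - 84840473570072418861390154818039 * x ^ 2 +
    89892936159247508635918340650863 * x - 38071342804685722005159817719130

/-- The first coordinate of a critical point of `drtonG`, in terms of the second. -/
def drtonFst {K : Type*} [Field K] (x : K) : K :=
  (28101333744 * x ^ 2 - 104233473859 * x + 101291156677) /
    (18430660791 * x ^ 2 - 78228698044 * x + 86287885764)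

theorem denom_ne_zero_of_drtonQuintic {K : Type*} [Field K] [CharZero K] {x : K}
    (hx : drtonQuintic x = 0) : 18430660791 * x ^ 2 - 78228698044 * x + 86287885764 ≠ 0 := by
  intro hp
  unfold drtonQuintic at hx
  have h : (6354577465717854162344175463265916015295177583092737538492153577735434930055283898832297520988760 : K) = 0 := by
    linear_combination
      (-204845965369020920134845270764886825333223121375111170997073577004390277581032112249498115
        + 385052030265880731541856422284533172344953878056325781370075641423314700443565373600357433 * x
        - 269034738797059423838736600300528973031943233160418842677031664157824831771867819144737110 * x ^ 2
        + 83735279824681355930108998794103189789075945108726127868273444001513855412353196209454217 * x ^ 3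
        - 9820151595715862684603234702708139944475573166768447898075369339041008189619499100464763 * x ^ 4)
          * hp
      + (-464445920049550515131847783113274666771213704894689535565397441251674
        + 196992035957374711669784998220501241881446262303572957911833654412717 * x) * hx
  norm_num at h

theorem critical_equations_iff {K : Type*} [Field K] [CharZero K] (a x : K) :
    ((18430660791 * x ^ 2 - 78228698044 * x + 86287885764) * a +
      (-28101333744 * x ^ 2 + 104233473859 * x - 101291156677) = 0 ∧
    (18430660791 * x - 39114349022) * a ^ 2 +
      (-56202667488 * x + 104233473859) * a + (56370060341 * x - 94024514009) = 0) ↔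
    drtonQuintic x = 0 ∧ a = drtonFst x := by
  set p : K := 18430660791 * x ^ 2 - 78228698044 * x + 86287885764 with hp
  set q : K := -28101333744 * x ^ 2 + 104233473859 * x - 101291156677 with hq
  have key : 5 * drtonQuintic x = (18430660791 * x - 39114349022) * q ^ 2
      - (-56202667488 * x + 104233473859) * (p * q) + (56370060341 * x - 94024514009) * p ^ 2 := by
    rw [drtonQuintic, hp, hq]; ring
  have fst_eq : drtonFst x = -q / p := by
    rw [drtonFst, hp, hq]; ring
  constructor
  · rintro ⟨h1, h2⟩
    have hR : drtonQuintic x = 0 := by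
      have : 5 * drtonQuintic x = 0 := by
        rw [key, eq_neg_of_add_eq_zero_right h1]
        linear_combination p ^ 2 * h2
      simpa using this
    refine ⟨hR, ?_⟩
    have hp0 : p ≠ 0 := denom_ne_zero_of_drtonQuintic hR
    rw [fst_eq, eq_div_iff hp0]
    linear_combination h1
  · rintro ⟨hR, rfl⟩
    have hp0 : p ≠ 0 := denom_ne_zero_of_drtonQuintic hR
    rw [hR] at key
    rw [fst_eq]
    clear_value p q
    refine ⟨by field_simp; ring, ?_⟩
    field_simp
    linear_combination -key

/-- A quintic with three known distinct roots factors off the corresponding cubic. -/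
theorem quintic_factor {K : Type*} [Field K] (c₀ c₁ c₂ c₃ c₄ c₅ r₁ r₂ r₃ s t : K)
    (h₁₂ : r₁ ≠ r₂) (h₁₃ : r₁ ≠ r₃) (h₂₃ : r₂ ≠ r₃)
    (h : ∀ r ∈ ({r₁, r₂, r₃} : Set K),
      c₅ * r ^ 5 + c₄ * r ^ 4 + c₃ * r ^ 3 + c₂ * r ^ 2 + c₁ * r + c₀ = 0)
    (hs : c₅ * (r₁ + r₂ + r₃) + c₄ = c₅ * s)
    (ht : c₅ * ((r₁ + r₂ + r₃) * s - (r₁ * r₂ + r₁ * r₃ + r₂ * r₃)) + c₃ = c₅ * t) (x : K) :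
    c₅ * x ^ 5 + c₄ * x ^ 4 + c₃ * x ^ 3 + c₂ * x ^ 2 + c₁ * x + c₀ =
      c₅ * ((x - r₁) * (x - r₂) * (x - r₃) * (x ^ 2 + s * x + t)) := by
  obtain ⟨a, b, c, hd⟩ : ∃ a b c : K, ∀ x,
      c₅ * x ^ 5 + c₄ * x ^ 4 + c₃ * x ^ 3 + c₂ * x ^ 2 + c₁ * x + c₀ -
      c₅ * ((x - r₁) * (x - r₂) * (x - r₃) * (x ^ 2 + s * x + t)) = a * x ^ 2 + b * x + c := by
    refine ⟨c₂ - c₅ * (-r₁ * r₂ * r₃ + (r₁ * r₂ + r₁ * r₃ + r₂ * r₃) * s - (r₁ + r₂ + r₃) * t),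
      c₁ - c₅ * ((r₁ * r₂ + r₁ * r₃ + r₂ * r₃) * t - r₁ * r₂ * r₃ * s),
      c₀ + c₅ * (r₁ * r₂ * r₃) * t, fun x => ?_⟩
    linear_combination x ^ 4 * hs + x ^ 3 * ht
  have e₁ := hd r₁
  have e₂ := hd r₂
  have e₃ := hd r₃
  rw [h r₁ (by simp)] at e₁
  rw [h r₂ (by simp)] at e₂
  rw [h r₃ (by simp)] at e₃
  have f₁₂ : a * (r₁ + r₂) + b = 0 :=
    mul_left_cancel₀ (sub_ne_zero.2 h₁₂) (by linear_combination e₂ - e₁)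
  have f₁₃ : a * (r₁ + r₃) + b = 0 :=
    mul_left_cancel₀ (sub_ne_zero.2 h₁₃) (by linear_combination e₃ - e₁)
  have ha : a = 0 := mul_left_cancel₀ (sub_ne_zero.2 h₂₃) (by linear_combination f₁₂ - f₁₃)
  have hb : b = 0 := by simpa [ha] using f₁₂
  have hc : c = 0 := by simpa [ha, hb] using e₁.symm
  have := hd x
  rw [ha, hb, hc] at this
  linear_combination this

theorem exists_drtonQuintic_root {a b : ℝ} (hab : a ≤ b)
    (h : drtonQuintic a * drtonQuintic b < 0) : ∃ r ∈ Set.Ioo a b, drtonQuintic r = 0 := by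
  have hc : ContinuousOn (drtonQuintic (K := ℝ)) (Set.Icc a b) := by
    unfold drtonQuintic; fun_prop
  rcases mul_neg_iff.1 h with ⟨h1, h2⟩ | ⟨h1, h2⟩
  · exact intermediate_value_Ioo' hab hc ⟨h2, h1⟩
  · exact intermediate_value_Ioo hab hc ⟨h1, h2⟩

theorem drtonQuintic_ofReal (x : ℝ) : drtonQuintic (x : ℂ) = (drtonQuintic x : ℝ) := by
  simp [drtonQuintic]

theorem drtonFst_ofReal (x : ℝ) : drtonFst (x : ℂ) = (drtonFst x : ℝ) := by
  simp [drtonFst]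

/-- The quintic has exactly three real roots and a pair of non-real conjugate ones. -/
theorem drtonQuintic_roots : ∃ r₁ r₂ r₃ u v : ℝ, r₁ < r₂ ∧ r₂ < r₃ ∧ 0 < v ∧
    ∀ x : ℂ, drtonQuintic x = 0 ↔ x = r₁ ∨ x = r₂ ∨ x = r₃ ∨ x = ⟨u, v⟩ ∨ x = ⟨u, -v⟩ := by
  obtain ⟨r₁, ⟨l₁, u₁⟩, h₁⟩ := exists_drtonQuintic_root (a := 1.538) (b := 1.5381)
    (by norm_num) (by norm_num [drtonQuintic])
  obtain ⟨r₂, ⟨l₂, u₂⟩, h₂⟩ := exists_drtonQuintic_root (a := 2.0347) (b := 2.0348)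
    (by norm_num) (by norm_num [drtonQuintic])
  obtain ⟨r₃, ⟨l₃, u₃⟩, h₃⟩ := exists_drtonQuintic_root (a := 2.504) (b := 2.5041)
    (by norm_num) (by norm_num [drtonQuintic])
  have h₁₂ : r₁ < r₂ := by linarith
  have h₂₃ : r₂ < r₃ := by linarith
  obtain ⟨s, hs⟩ : ∃ s : ℝ, s = r₁ + r₂ + r₃
    - 9567857224000144024273044854829 / 918777665793553181376677373249 := ⟨_, rfl⟩
  obtain ⟨t, ht⟩ : ∃ t : ℝ, t = (r₁ + r₂ + r₃) * s - (r₁ * r₂ + r₁ * r₃ + r₂ * r₃)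
    + 40167094888463786054331112336432 / 918777665793553181376677373249 := ⟨_, rfl⟩
  have hdisc : 0 < t - s ^ 2 / 4 := by
    have ls : -4.34 < s := by rw [hs]; norm_num at *; linarith
    have us : s < -4.33 := by rw [hs]; norm_num at *; linarith
    have b₁ : r₁ * r₂ < 3.13 := by nlinarith
    have b₂ : r₁ * r₃ < 3.86 := by nlinarith
    have b₃ : r₂ * r₃ < 5.1 := by nlinarith
    have b₄ : -26.4 < (r₁ + r₂ + r₃) * s := by nlinarith
    have b₅ : s ^ 2 / 4 < 4.72 := by nlinarith
    have b₆ : (43.7 : ℝ) < 40167094888463786054331112336432 / 918777665793553181376677373249 := by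
      norm_num
    rw [ht]
    linarith
  have hfac (x : ℂ) : drtonQuintic x = 918777665793553181376677373249 *
      ((x - r₁) * (x - r₂) * (x - r₃) * (x ^ 2 + s * x + t)) := by
    have := quintic_factor (-38071342804685722005159817719130 : ℂ)
      89892936159247508635918340650863 (-84840473570072418861390154818039)
      40167094888463786054331112336432 (-9567857224000144024273044854829)
      918777665793553181376677373249 r₁ r₂ r₃ s t
      (by exact_mod_cast h₁₂.ne) (by exact_mod_cast (h₁₂.trans h₂₃).ne) (by exact_mod_cast h₂₃.ne)
      (fun r hr => ?_) (by rw [hs]; push_cast; ring) (by rw [ht]; push_cast; ring) x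
    · rw [← this, drtonQuintic]; ring
    · have : drtonQuintic r = 0 := by
        rcases hr with rfl | rfl | rfl <;> rw [drtonQuintic_ofReal] <;> simp [*]
      rw [← this, drtonQuintic]; ring
  refine ⟨r₁, r₂, r₃, -s / 2, √(t - s ^ 2 / 4), h₁₂, h₂₃, Real.sqrt_pos.2 hdisc, fun x => ?_⟩
  have hv : √(t - s ^ 2 / 4) ^ 2 = t - s ^ 2 / 4 := Real.sq_sqrt hdisc.le
  set v := √(t - s ^ 2 / 4)
  have hq : x ^ 2 + s * x + t = (x - ⟨-s / 2, v⟩) * (x - ⟨-s / 2, -v⟩) := by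
    have ht' : t = v ^ 2 + s ^ 2 / 4 := by linarith
    rw [ht', Complex.mk_eq_add_mul_I, Complex.mk_eq_add_mul_I]
    push_cast
    linear_combination v ^ 2 * Complex.I_sq
  rw [hfac, hq]
  simp [sub_eq_zero, or_assoc]

/-- The residual sum-of-squares matrix `(Y - B X)(Y - B X)ᵀ`. -/
noncomputable def drtonS (b : Fin 2 → ℝ) : Matrix (Fin 2) (Fin 2) ℝ :=
  (drtonYr - !![b 0, 0; 0, b 1] * drtonXr) * (drtonYr - !![b 0, 0; 0, b 1] * drtonXr)ᵀ

theorem drtonS_eq (b : Fin 2 → ℝ) : drtonS b =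
    !![77048 * b 0 ^ 2 - 192698 * b 0 + 210942,
       235177 - 34414 * b 0 - 35083 * b 1 - 51073 * (b 0 * b 1);
       235177 - 34414 * b 0 - 35083 * b 1 - 51073 * (b 0 * b 1),
       273065 * b 1 ^ 2 - 969700 * b 1 + 1135295] := by
  ext i j
  fin_cases i <;> fin_cases j <;>
  · simp [drtonS, Matrix.mul_apply, Fin.sum_univ_eight, drtonXr, drtonYr]
    ring

theorem drtonS_posDef (b : Fin 2 → ℝ) : (drtonS b).PosDef := by
  have h := Matrix.PosDef.mul_conjTranspose_self (drtonYr - !![b 0, 0; 0, b 1] * drtonXr) ?_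
  · simpa only [conjTranspose_eq_transpose_of_trivial, drtonS] using h
  · intro x y hxy
    have e (j : Fin 8) := congrFun hxy j
    simp only [Fin.forall_fin_succ, Fin.forall_fin_zero, Matrix.vecMul, dotProduct,
      Fin.sum_univ_two, drtonXr, drtonYr] at e
    simp at e
    obtain ⟨e₀, e₁, e₂, e₃, -⟩ := e
    have f₀ : x 0 = y 0 := by linarith
    have f₁ : x 1 = y 1 := by linarith
    ext i
    fin_cases i <;> assumption

/-- The log-likelihood in coordinates. -/
theorem drtonLogLik_eq (p : (Fin 2 → ℝ) × Matrix (Fin 2) (Fin 2) ℝ) : drtonLogLik p =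
    -8 * Real.log (2 * Real.pi)
      - 4 * Real.log (p.2 0 0 * p.2 1 1 - p.2 0 1 * p.2 1 0)
      - 1 / 2 * ((p.2 0 0 * p.2 1 1 - p.2 0 1 * p.2 1 0)⁻¹ *
        (p.2 1 1 * (77048 * p.1 0 ^ 2 - 192698 * p.1 0 + 210942)
          - (p.2 0 1 + p.2 1 0) *
            (235177 - 34414 * p.1 0 - 35083 * p.1 1 - 51073 * (p.1 0 * p.1 1))
          + p.2 0 0 * (273065 * p.1 1 ^ 2 - 969700 * p.1 1 + 1135295))) := by
  have h : drtonLogLik p = -(2 * 8 / 2 : ℝ) * Real.log (2 * Real.pi)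
      - (8 / 2 : ℝ) * Real.log p.2.det - (1 / 2 : ℝ) * (p.2⁻¹ * drtonS p.1).trace := rfl
  rw [h, drtonS_eq, Matrix.inv_def, Matrix.adjugate_fin_two, Matrix.det_fin_two,
    Ring.inverse_eq_inv']
  simp [Matrix.trace_fin_two]
  ring

theorem fderiv_coordinates_apply {E : Type*} [NormedAddCommGroup E] [NormedSpace ℝ E]
    (x y a b c d : E →L[ℝ] ℝ) (k : ℝ) (p v : E) (Δ N A C D : ℝ)
    (hΔ : a p * d p - b p * c p = Δ) (h0 : Δ ≠ 0)
    (hA : 77048 * x p ^ 2 - 192698 * x p + 210942 = A)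
    (hC : 235177 - 34414 * x p - 35083 * y p - 51073 * (x p * y p) = C)
    (hD : 273065 * y p ^ 2 - 969700 * y p + 1135295 = D)
    (hN : d p * A - (b p + c p) * C + a p * D = N) :
    fderiv ℝ (fun q => k - 4 * Real.log (a q * d q - b q * c q)
      - 1 / 2 * ((a q * d q - b q * c q)⁻¹ *
        (d q * (77048 * x q ^ 2 - 192698 * x q + 210942)
          - (b q + c q) * (235177 - 34414 * x q - 35083 * y q - 51073 * (x q * y q))
          + a q * (273065 * y q ^ 2 - 969700 * y q + 1135295)))) p v =
    -(1 / (2 * Δ ^ 2)) *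
      (((8 * Δ - N) * d p + Δ * D) * a v
      + ((8 * Δ - N) * a p + Δ * A) * d v
      - ((8 * Δ - N) * c p + Δ * C) * b v
      - ((8 * Δ - N) * b p + Δ * C) * c v
      + Δ * (d p * (2 * 77048 * x p - 192698) + (b p + c p) * (34414 + 51073 * y p)) * x v
      + Δ * (a p * (2 * 273065 * y p - 969700) + (b p + c p) * (35083 + 51073 * x p)) * y v) := by
  have hdet := (a.hasFDerivAt.mul d.hasFDerivAt).sub (b.hasFDerivAt.mul (c.hasFDerivAt (x := p)))
  have hne : a p * d p - b p * c p ≠ 0 := hΔ ▸ h0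
  have hx := x.hasFDerivAt (x := p)
  have hy := y.hasFDerivAt (x := p)
  have dA := (((hx.pow 2).const_mul 77048).sub (hx.const_mul 192698)).add_const 210942
  have dD := (((hy.pow 2).const_mul 273065).sub (hy.const_mul 969700)).add_const 1135295
  have dC := (((hasFDerivAt_const (235177 : ℝ) p).sub (hx.const_mul 34414)).sub
    (hy.const_mul 35083)).sub ((hx.mul hy).const_mul 51073)
  have hnum := ((d.hasFDerivAt.mul dA).sub ((b.hasFDerivAt.add c.hasFDerivAt).mul dC)).add
    (a.hasFDerivAt.mul dD)
  have hinv := (hasDerivAt_inv hne).comp_hasFDerivAt p hdet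
  have hF := (((hasFDerivAt_const k p).sub
    ((hdet.log hne).const_mul 4)).sub ((hinv.mul hnum).const_mul (1 / 2)))
  refine (DFunLike.congr_fun hF.fderiv v).trans ?_
  clear hF hinv hnum dA dC dD hdet hx hy
  simp
  rw [hΔ, hA, hC, hD, hN]
  field_simp
  ring

theorem fderiv_drtonLogLik_apply (p v : (Fin 2 → ℝ) × Matrix (Fin 2) (Fin 2) ℝ) (Δ N : ℝ)
    (hΔ : p.2 0 0 * p.2 1 1 - p.2 0 1 * p.2 1 0 = Δ) (h0 : Δ ≠ 0)
    (hN : p.2 1 1 * drtonS p.1 0 0 - (p.2 0 1 + p.2 1 0) * drtonS p.1 0 1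
      + p.2 0 0 * drtonS p.1 1 1 = N) :
    fderiv ℝ drtonLogLik p v = -(1 / (2 * Δ ^ 2)) *
      (((8 * Δ - N) * p.2 1 1 + Δ * drtonS p.1 1 1) * v.2 0 0
      + ((8 * Δ - N) * p.2 0 0 + Δ * drtonS p.1 0 0) * v.2 1 1
      - ((8 * Δ - N) * p.2 1 0 + Δ * drtonS p.1 0 1) * v.2 0 1
      - ((8 * Δ - N) * p.2 0 1 + Δ * drtonS p.1 0 1) * v.2 1 0
      + Δ * (p.2 1 1 * (2 * 77048 * p.1 0 - 192698)
          + (p.2 0 1 + p.2 1 0) * (34414 + 51073 * p.1 1)) * v.1 0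
      + Δ * (p.2 0 0 * (2 * 273065 * p.1 1 - 969700)
          + (p.2 0 1 + p.2 1 0) * (35083 + 51073 * p.1 0)) * v.1 1) := by
  let coord (i : Fin 2) : (Fin 2 → ℝ) × Matrix (Fin 2) (Fin 2) ℝ →L[ℝ] ℝ :=
    (ContinuousLinearMap.proj (R := ℝ) (φ := fun _ : Fin 2 => ℝ) i).comp
      (ContinuousLinearMap.fst ℝ (Fin 2 → ℝ) (Matrix (Fin 2) (Fin 2) ℝ))
  let entry (i j : Fin 2) : (Fin 2 → ℝ) × Matrix (Fin 2) (Fin 2) ℝ →L[ℝ] ℝ :=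
    (Matrix.entryLinearMap ℝ ℝ i j).toContinuousLinearMap.comp
      (ContinuousLinearMap.snd ℝ (Fin 2 → ℝ) (Matrix (Fin 2) (Fin 2) ℝ))
  rw [funext drtonLogLik_eq]
  exact fderiv_coordinates_apply (coord 0) (coord 1) (entry 0 0) (entry 0 1) (entry 1 0)
    (entry 1 1) (-8 * Real.log (2 * Real.pi)) p v Δ N _ _ _ hΔ h0
    (by rw [drtonS_eq]; rfl) (by rw [drtonS_eq]; rfl) (by rw [drtonS_eq]; rfl) hN

theorem stationary_iff (p : (Fin 2 → ℝ) × Matrix (Fin 2) (Fin 2) ℝ) :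
    (p.2.PosDef ∧ fderiv ℝ drtonLogLik p = 0) ↔
      drtonQuintic (p.1 1) = 0 ∧ p.1 0 = drtonFst (p.1 1) ∧ p.2 = (1 / 8 : ℝ) • drtonS p.1 := by
  rw [← and_assoc, ← critical_equations_iff]
  have hsym : drtonS p.1 1 0 = drtonS p.1 0 1 := by rw [drtonS_eq]; rfl
  constructor
  · rintro ⟨hpos, hd⟩
    have hbc : p.2 1 0 = p.2 0 1 := by simpa using hpos.1.apply 0 1
    have hdet := hpos.det_pos
    rw [Matrix.det_fin_two] at hdet
    obtain ⟨Δ, hΔ⟩ : ∃ Δ, p.2 0 0 * p.2 1 1 - p.2 0 1 * p.2 1 0 = Δ := ⟨_, rfl⟩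
    obtain ⟨N, hN⟩ : ∃ N, p.2 1 1 * drtonS p.1 0 0 - (p.2 0 1 + p.2 1 0) * drtonS p.1 0 1
      + p.2 0 0 * drtonS p.1 1 1 = N := ⟨_, rfl⟩
    rw [hΔ] at hdet
    have key (v : (Fin 2 → ℝ) × Matrix (Fin 2) (Fin 2) ℝ) :=
      (fderiv_drtonLogLik_apply p v Δ N hΔ hdet.ne' hN).symm.trans (by rw [hd]; rfl : _ = (0 : ℝ))
    have hc : -(1 / (2 * Δ ^ 2)) ≠ 0 := by
      have := hdet.ne'
      simp [this]
    have e₁ := (mul_eq_zero.1 (key (0, !![1, 0; 0, 0]))).resolve_left hc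
    have e₂ := (mul_eq_zero.1 (key (0, !![0, 0; 0, 1]))).resolve_left hc
    have e₃ := (mul_eq_zero.1 (key (0, !![0, 1; 0, 0]))).resolve_left hc
    have e₄ := (mul_eq_zero.1 (key (![1, 0], 0))).resolve_left hc
    have e₅ := (mul_eq_zero.1 (key (![0, 1], 0))).resolve_left hc
    clear key
    rw [hbc] at hΔ hN
    simp [hdet.ne', hbc] at e₁ e₂ e₃ e₄ e₅
    have hN16 : N = 16 * Δ := by
      apply mul_left_cancel₀ hdet.ne'
      linear_combination -p.2 1 1 * e₂ - p.2 0 0 * e₁ - 2 * p.2 0 1 * e₃ + Δ * hN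
        + 2 * (8 * Δ - N) * hΔ
    subst hN16
    have f₁ : drtonS p.1 1 1 = 8 * p.2 1 1 :=
      mul_left_cancel₀ hdet.ne' (by linear_combination e₁)
    have f₂ : drtonS p.1 0 0 = 8 * p.2 0 0 :=
      mul_left_cancel₀ hdet.ne' (by linear_combination e₂)
    have f₃ : drtonS p.1 0 1 = 8 * p.2 0 1 :=
      mul_left_cancel₀ hdet.ne' (by linear_combination -e₃)
    refine ⟨?_, ?_⟩
    · rw [drtonS_eq] at f₁ f₂ f₃
      simp at f₁ f₂ f₃
      constructor
      · linear_combination 4 * e₄ + (77048 * p.1 0 - 96349) * f₁ + (34414 + 51073 * p.1 1) * f₃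
      · linear_combination 4 * e₅ + (273065 * p.1 1 - 484850) * f₂ + (35083 + 51073 * p.1 0) * f₃
    · ext i j
      fin_cases i <;> fin_cases j <;> simp [f₁, f₂, f₃, hsym, hbc]
  · rintro ⟨⟨h₁, h₂⟩, hS⟩
    have hpos : p.2.PosDef := by
      rw [hS]
      exact (drtonS_posDef p.1).smul (by norm_num)
    refine ⟨hpos, ?_⟩
    have hdet := hpos.det_pos
    rw [Matrix.det_fin_two] at hdet
    have g (i j : Fin 2) : p.2 i j = 1 / 8 * drtonS p.1 i j := by
      conv_lhs => rw [hS]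
      simp
    refine ContinuousLinearMap.ext fun v => ?_
    rw [fderiv_drtonLogLik_apply p v _ _ rfl hdet.ne' rfl]
    generalize -(1 / (2 * (p.2 0 0 * p.2 1 1 - p.2 0 1 * p.2 1 0) ^ 2)) = k
    simp only [g, hsym]
    have d₁ : 1 / 8 * drtonS p.1 1 1 * (2 * 77048 * p.1 0 - 192698)
        + (1 / 8 * drtonS p.1 0 1 + 1 / 8 * drtonS p.1 0 1) * (34414 + 51073 * p.1 1) = 0 := by
      rw [drtonS_eq]
      simp
      linear_combination (1 / 4) * h₁
    have d₂ : 1 / 8 * drtonS p.1 0 0 * (2 * 273065 * p.1 1 - 969700)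
        + (1 / 8 * drtonS p.1 0 1 + 1 / 8 * drtonS p.1 0 1) * (35083 + 51073 * p.1 0) = 0 := by
      rw [drtonS_eq]
      simp
      linear_combination (1 / 4) * h₂
    rw [d₁, d₂, _root_.zero_apply]
    ring

theorem mem_drtonCrit_iff (z : Fin 2 → ℂ) :
    z ∈ drtonCrit ↔ drtonQuintic (z 1) = 0 ∧ z = ![drtonFst (z 1), z 1] := by
  rw [mem_drtonCrit, critical_equations_iff]
  refine and_congr_right fun _ => ⟨fun h => ?_, fun h => congrFun h 0⟩
  ext i
  fin_cases i
  · exact h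
  · rfl

theorem drtonCrit_eq_image :
    drtonCrit = (fun x : ℂ => ![drtonFst x, x]) '' {x | drtonQuintic x = 0} := by
  ext z
  rw [mem_drtonCrit_iff]
  constructor
  · rintro ⟨h, hz⟩
    exact ⟨z 1, h, hz.symm⟩
  · rintro ⟨x, hx, rfl⟩
    exact ⟨hx, rfl⟩

theorem real_drtonCrit_eq_image : {z ∈ drtonCrit | ∀ i, (z i).im = 0} =
    (fun x : ℝ => ![drtonFst (x : ℂ), (x : ℂ)]) '' {x | drtonQuintic x = 0} := by
  ext z
  rw [Set.mem_sep_iff, mem_drtonCrit_iff]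
  constructor
  · rintro ⟨⟨h, hz⟩, him⟩
    have hx : ((z 1).re : ℂ) = z 1 := Complex.ext rfl (him 1).symm
    refine ⟨(z 1).re, ?_, ?_⟩
    · rw [← hx, drtonQuintic_ofReal] at h
      exact_mod_cast h
    · simp only [hx]
      exact hz.symm
  · rintro ⟨x, hx, rfl⟩
    refine ⟨⟨?_, rfl⟩, ?_⟩
    · change drtonQuintic (x : ℂ) = 0
      rw [drtonQuintic_ofReal, hx, Complex.ofReal_zero]
    · simp [Fin.forall_fin_two, drtonFst_ofReal]

theorem stationary_eq_image : {p : (Fin 2 → ℝ) × Matrix (Fin 2) (Fin 2) ℝ |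
      p.2.PosDef ∧ fderiv ℝ drtonLogLik p = 0} =
    (fun x : ℝ => (![drtonFst x, x], (1 / 8 : ℝ) • drtonS ![drtonFst x, x])) ''
      {x | drtonQuintic x = 0} := by
  ext p
  rw [Set.mem_ofPred_eq, stationary_iff]
  constructor
  · rintro ⟨h, h0, hS⟩
    have hp : ![drtonFst (p.1 1), p.1 1] = p.1 := by
      ext i
      fin_cases i
      · exact h0.symm
      · rfl
    refine ⟨p.1 1, h, ?_⟩
    simp only [hp]
    exact Prod.ext rfl hS.symm
  · rintro ⟨x, hx, rfl⟩
    exact ⟨hx, rfl, rfl⟩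

theorem drtonQuintic_complex_roots_ncard : {x : ℂ | drtonQuintic x = 0}.ncard = 5 := by
  obtain ⟨r₁, r₂, r₃, u, v, h₁₂, h₂₃, hv, h⟩ := drtonQuintic_roots
  have hset : {x : ℂ | drtonQuintic x = 0} =
      (({(r₁ : ℂ), (r₂ : ℂ), (r₃ : ℂ), ⟨u, v⟩, ⟨u, -v⟩} : Finset ℂ) : Set ℂ) := by
    ext x
    simp [h]
  have hvv : v ≠ -v := by linarith
  rw [hset, Set.ncard_coe_finset]
  repeat rw [Finset.card_insert_of_notMem]
  · simp
  all_goals simp [Complex.ext_iff, h₁₂.ne, h₂₃.ne, (h₁₂.trans h₂₃).ne, hv.ne, hv.ne', hvv]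

theorem drtonQuintic_real_roots_ncard : {x : ℝ | drtonQuintic x = 0}.ncard = 3 := by
  obtain ⟨r₁, r₂, r₃, u, v, h₁₂, h₂₃, hv, h⟩ := drtonQuintic_roots
  have hset : {x : ℝ | drtonQuintic x = 0} = {r₁, r₂, r₃} := by
    ext x
    have := h x
    rw [drtonQuintic_ofReal] at this
    simpa [Complex.ext_iff, hv.ne, hv.ne'] using this
  rw [hset, Set.ncard_eq_three]
  exact ⟨r₁, r₂, r₃, h₁₂.ne, (h₁₂.trans h₂₃).ne, h₂₃.ne, rfl⟩

/-- For the Drton (2004) data, the system ∂G/∂β₁ = ∂G/∂β₂ = 0 has exactly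
five complex solutions, exactly three of which are real; consequently the likelihood
function of the SUR model with C_R = {(1,1),(2,2)} has exactly three stationary points. -/
theorem drton_critical_points :
    drtonCrit.Finite ∧ drtonCrit.ncard = 5
    ∧ {z ∈ drtonCrit | ∀ i, (z i).im = 0}.ncard = 3
    ∧ {p : (Fin 2 → ℝ) × Matrix (Fin 2) (Fin 2) ℝ |
        p.2.PosDef ∧ fderiv ℝ drtonLogLik p = 0}.ncard = 3 := by
  have hcard : drtonCrit.ncard = 5 := by
    rw [drtonCrit_eq_image, Set.ncard_image_of_injective _ fun x y h => congrFun h 1,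
      drtonQuintic_complex_roots_ncard]
  refine ⟨Set.finite_of_ncard_ne_zero (by simp [hcard]), hcard, ?_, ?_⟩
  · rw [real_drtonCrit_eq_image, Set.ncard_image_of_injective _
      fun x y h => Complex.ofReal_injective (congrFun h 1), drtonQuintic_real_roots_ncard]
  · rw [stationary_eq_image, Set.ncard_image_of_injective _
      fun x y h => congrFun (congrArg Prod.fst h) 1, drtonQuintic_real_roots_ncard]
end

section
/- Let X and Y be the rational 2×5 matrices X = [[−0.65,−0.80,1.34,−1.03,−1.08],[−0.04,−1.18,1.98,−2.42,−3.75]] and Y = [[0.14,−0.73,1.40,−2.29,−3.30],[0.52,−1.93,3.02,−6.67,−9.94]], and for (β₁,β₂) ∈ ℂ² let G(β₁,β₂) = det((Y − B(β₁,β₂)X)(Y − B(β₁,β₂)X)ᵀ) with B(β₁,β₂) = [[β₁,0],[0,β₂]]. Then the system ∂G/∂β₁ = 0, ∂G/∂β₂ = 0 has exactly five solutions in ℂ², and every one of these five solutions lies in ℝ²; i.e., the variety of the maximum likelihood ideal is purely real with five points, so the likelihood function of the model with C_R = {(1,1),(2,2)} for these data has exactly five stationary points. -/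
open Matrix MvPolynomial

attribute [local instance] Matrix.normedAddCommGroup Matrix.normedSpace

/-- The covariate data X of (13) in the paper, as a matrix of constant polynomials. -/
noncomputable def triXp : Matrix (Fin 2) (Fin 5) (MvPolynomial (Fin 2) ℂ) :=
  !![C (-0.65), C (-0.80), C 1.34, C (-1.03), C (-1.08);
     C (-0.04), C (-1.18), C 1.98, C (-2.42), C (-3.75)]

/-- The response data Y of (13) in the paper, as a matrix of constant polynomials. -/
noncomputable def triYp : Matrix (Fin 2) (Fin 5) (MvPolynomial (Fin 2) ℂ) :=
  !![C 0.14, C (-0.73), C 1.40, C (-2.29), C (-3.30);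
     C 0.52, C (-1.93), C 3.02, C (-6.67), C (-9.94)]

/-- The diagonal coefficient matrix B(β₁,β₂) = [[β₁,0],[0,β₂]] in polynomial variables. -/
noncomputable def triBp : Matrix (Fin 2) (Fin 2) (MvPolynomial (Fin 2) ℂ) :=
  !![X 0, 0; 0, X 1]

/-- The polynomial G(β₁,β₂) = det((Y − B(β₁,β₂)X)(Y − B(β₁,β₂)X)ᵀ). -/
noncomputable def triG : MvPolynomial (Fin 2) ℂ :=
  ((triYp - triBp * triXp) * (triYp - triBp * triXp)ᵀ).det

/-- The set of complex solutions of the critical equations ∂G/∂β₁ = ∂G/∂β₂ = 0,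
i.e. the variety of the maximum likelihood ideal. -/
noncomputable def triCrit : Set (Fin 2 → ℂ) :=
  {z | eval z (pderiv 0 triG) = 0 ∧ eval z (pderiv 1 triG) = 0}

/-- The real data matrices. -/
noncomputable def triXr : Matrix (Fin 2) (Fin 5) ℝ :=
  !![-0.65, -0.80, 1.34, -1.03, -1.08;
     -0.04, -1.18, 1.98, -2.42, -3.75]

noncomputable def triYr : Matrix (Fin 2) (Fin 5) ℝ :=
  !![0.14, -0.73, 1.40, -2.29, -3.30;
     0.52, -1.93, 3.02, -6.67, -9.94]

/-- The log-likelihood of the SUR model with C_R = {(1,1),(2,2)} for these data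
(R = 2, N = 5), as a function on (β₁,β₂) × (2×2 matrices). -/
noncomputable def triLogLik (p : (Fin 2 → ℝ) × Matrix (Fin 2) (Fin 2) ℝ) : ℝ :=
  -(2 * 5 / 2 : ℝ) * Real.log (2 * Real.pi) - (5 / 2 : ℝ) * Real.log p.2.det
    - (1 / 2 : ℝ) * (p.2⁻¹ * ((triYr - !![p.1 0, 0; 0, p.1 1] * triXr) *
        (triYr - !![p.1 0, 0; 0, p.1 1] * triXr)ᵀ)).trace

/-- A real polynomial of degree at most `n` whose values alternate in sign along `n + 1` increasing
points has exactly `n` complex roots, all of them real. -/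
theorem Polynomial.exists_aeval_eq_zero_iff_of_alternating {n : ℕ} {p : Polynomial ℝ}
    (hdeg : p.natDegree ≤ n) (hp : p ≠ 0) {t : Fin (n + 1) → ℝ} (ht : StrictMono t)
    (halt : ∀ i : Fin n, p.eval (t i.castSucc) * p.eval (t i.succ) < 0) :
    ∃ r : Fin n → ℝ, Function.Injective r ∧
      ∀ z : ℂ, Polynomial.aeval z p = 0 ↔ ∃ i, (r i : ℂ) = z := by
  have hroot (i : Fin n) : ∃ x ∈ Set.Ioo (t i.castSucc) (t i.succ), p.eval x = 0 := by
    have hlt : t i.castSucc < t i.succ := ht i.castSucc_lt_succ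
    have hc : ContinuousOn (fun x => p.eval x) (Set.Icc (t i.castSucc) (t i.succ)) :=
      p.continuous.continuousOn
    rcases mul_neg_iff.1 (halt i) with ⟨h₁, h₂⟩ | ⟨h₁, h₂⟩
    · exact intermediate_value_Ioo' hlt.le hc ⟨h₂, h₁⟩
    · exact intermediate_value_Ioo hlt.le hc ⟨h₁, h₂⟩
  choose r hr hr0 using hroot
  have hmono : StrictMono r := fun i j hij =>
    (hr i).2.trans_le ((ht.monotone (Fin.succ_le_castSucc_iff.2 hij)).trans (hr j).1.le)
  refine ⟨r, hmono.injective, fun z => ⟨fun hz => ?_, ?_⟩⟩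
  · let q := p.map (algebraMap ℝ ℂ)
    have hq : q ≠ 0 := (Polynomial.map_ne_zero_iff (algebraMap ℝ ℂ).injective).2 hp
    let s : Finset ℂ := Finset.univ.image fun i => (r i : ℂ)
    have hs : s.card = n := by
      rw [Finset.card_image_of_injective _ fun i j hij =>
        hmono.injective (Complex.ofReal_injective hij), Finset.card_fin]
    have hsub : s ⊆ q.roots.toFinset := by
      intro w hw
      obtain ⟨i, -, rfl⟩ := Finset.mem_image.1 hw
      rw [Multiset.mem_toFinset, Polynomial.mem_roots hq, Polynomial.IsRoot.def]
      exact (Polynomial.eval_map_apply (f := algebraMap ℝ ℂ) (r i)).trans (by simp [hr0])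
    have hcard : q.roots.toFinset.card ≤ s.card :=
      calc q.roots.toFinset.card ≤ q.roots.card := q.roots.toFinset_card_le
        _ ≤ q.natDegree := q.card_roots'
        _ ≤ s.card := by rw [hs]; exact Polynomial.natDegree_map_le.trans hdeg
    have hmem : z ∈ q.roots.toFinset := by
      rwa [Multiset.mem_toFinset, Polynomial.mem_roots hq, Polynomial.IsRoot.def,
        Polynomial.eval_map_algebraMap]
    rw [← Finset.eq_of_subset_of_card_le hsub hcard] at hmem
    obtain ⟨i, -, hi⟩ := Finset.mem_image.1 hmem
    exact ⟨i, hi⟩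
  · rintro ⟨i, rfl⟩
    exact (Polynomial.aeval_algebraMap_apply ℂ (r i) p).trans (by simp [hr0])

section CriticalEquations

variable {K : Type*} [Field K]

/-- The coefficient of `β₁²` in `10⁸ G`, as a polynomial in `β₂`. -/
def triQuad (y : K) : K := 2497793418 * y ^ 2 - 16231451812 * y + 27290552467

/-- Half the coefficient of `β₁` in `10⁸ G`, as a polynomial in `β₂`. -/
def triLin (y : K) : K := 979114107 * y ^ 2 - 1683661322 * y - 6744410534

/-- Half of `∂G/∂β₂`, up to the factor `10⁸`. -/
def triPartial (x y : K) : K :=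
  (2497793418 * y - 8115725906) * x ^ 2 + (1958228214 * y - 1683661322) * x
    + (634546262 * y + 918648444)

/-- The eliminant of `β₁` from the two critical equations, as a polynomial in `β₂`. -/
def triElim (y : K) : K :=
  (2497793418 * y - 8115725906) * triLin y ^ 2
    - (1958228214 * y - 1683661322) * triLin y * triQuad y
    + (634546262 * y + 918648444) * triQuad y ^ 2

theorem triQuad_ne_zero_of_eq [CharZero K] {x y : K} (h : triQuad y * x + triLin y = 0) :
    triQuad y ≠ 0 := by
  intro h₁
  have h₂ : triLin y = 0 := by simpa [h₁] using h
  unfold triQuad at h₁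
  unfold triLin at h₂
  have : (1 : K) = 0 := by
    linear_combination
      ((7659940255395490035194661877 + 3814303912086886255590031272 * y) * h₁
        + (26958807880499274170744401066 - 9730574953162507271818366128 * y) * h₂)
        / 27222733580634482744132943341541971315
  exact one_ne_zero this

theorem triPartial_mul_triQuad_sq {x y : K} (h : triQuad y * x + triLin y = 0) :
    triPartial x y * triQuad y ^ 2 = triElim y := by
  unfold triPartial triElim
  linear_combination ((2497793418 * y - 8115725906) * (triQuad y * x - triLin y)
    + (1958228214 * y - 1683661322) * triQuad y) * h

theorem tri_critical_equations_iff [CharZero K] {x y : K} (hy : triElim y = 0 → triQuad y ≠ 0) :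
    triQuad y * x + triLin y = 0 ∧ triPartial x y = 0 ↔
      triElim y = 0 ∧ x = -triLin y / triQuad y := by
  constructor
  · rintro ⟨h₁, h₂⟩
    have hA := triQuad_ne_zero_of_eq h₁
    refine ⟨by rw [← triPartial_mul_triQuad_sq h₁, h₂, zero_mul], ?_⟩
    rw [eq_div_iff hA]
    linear_combination h₁
  · rintro ⟨h₁, rfl⟩
    have hA := hy h₁
    have h : triQuad y * (-triLin y / triQuad y) + triLin y = 0 := by field_simp; ring
    refine ⟨h, ?_⟩
    simpa [h₁, hA] using triPartial_mul_triQuad_sq h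

end CriticalEquations

theorem ofReal_triQuad (y : ℝ) : ((triQuad y : ℝ) : ℂ) = triQuad (y : ℂ) := by
  simp [triQuad]

theorem ofReal_triLin (y : ℝ) : ((triLin y : ℝ) : ℂ) = triLin (y : ℂ) := by
  simp [triLin]

theorem ofReal_triElim (y : ℝ) : ((triElim y : ℝ) : ℂ) = triElim (y : ℂ) := by
  simp [triElim, ofReal_triQuad, ofReal_triLin]

theorem triQuad_pos (y : ℝ) : 0 < triQuad y := by
  unfold triQuad
  nlinarith [sq_nonneg (y - 3.25)]

/-- `triElim` as a univariate polynomial. -/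
noncomputable def triElimPoly : Polynomial ℝ :=
  .C 782185310339065421902543503 * .X ^ 5 - .C 9131391218631382267635312687 * .X ^ 4
    + .C 36678804522961820280172962001 * .X ^ 3 - .C 57873177438797810183400804133 * .X ^ 2
    + .C 27710127980821981737743716919 * .X + .C 2566296289534295361854585232

theorem aeval_triElimPoly {K : Type*} [Field K] [Algebra ℝ K] (y : K) :
    Polynomial.aeval y triElimPoly * 2 = triElim y := by
  simp only [triElimPoly, triElim, triQuad, triLin, map_add, map_sub, map_mul, map_pow,
    Polynomial.aeval_X, map_ofNat]
  ring

theorem exists_triElim_roots : ∃ r : Fin 5 → ℝ, Function.Injective r ∧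
    ∀ z : ℂ, triElim z = 0 ↔ ∃ i, (r i : ℂ) = z := by
  have hdeg : triElimPoly.natDegree ≤ 5 := by
    unfold triElimPoly
    compute_degree
  have hp : triElimPoly ≠ 0 := by
    intro h
    have := congrArg (Polynomial.eval 0) h
    norm_num [triElimPoly] at this
  have ht : StrictMono (![-1, 1, 2, 3, 4, 5] : Fin 6 → ℝ) := by
    rw [Fin.strictMono_iff_lt_succ]
    intro i
    fin_cases i <;> norm_num [Fin.succ]
  obtain ⟨r, hr, h⟩ := Polynomial.exists_aeval_eq_zero_iff_of_alternating hdeg hp ht (by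
    intro i
    fin_cases i <;> norm_num [triElimPoly, Fin.succ])
  refine ⟨r, hr, fun z => ?_⟩
  rw [← h, ← aeval_triElimPoly]
  simp

theorem triCrit_eq : triCrit =
    {z | triQuad (z 1) * z 0 + triLin (z 1) = 0 ∧ triPartial (z 0) (z 1) = 0} := by
  have h₀ (z : Fin 2 → ℂ) : eval z (pderiv 0 triG) =
      (triQuad (z 1) * z 0 + triLin (z 1)) * 2 / 10 ^ 8 := by
    simp only [triG, det_fin_two, Matrix.mul_apply, Matrix.sub_apply, transpose_apply,
      Fin.sum_univ_five, Fin.sum_univ_two]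
    simp [triYp, triBp, triXp, triQuad, triLin, pderiv_X]
    ring
  have h₁ (z : Fin 2 → ℂ) : eval z (pderiv 1 triG) = triPartial (z 0) (z 1) * 2 / 10 ^ 8 := by
    simp only [triG, det_fin_two, Matrix.mul_apply, Matrix.sub_apply, transpose_apply,
      Fin.sum_univ_five, Fin.sum_univ_two]
    simp [triYp, triBp, triXp, triPartial, pderiv_X]
    ring
  ext z
  simp [triCrit, h₀, h₁]

/-- The residual matrix `Y - B(β₁,β₂) X`. -/
noncomputable def triResid (b : Fin 2 → ℝ) : Matrix (Fin 2) (Fin 5) ℝ :=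
  triYr - !![b 0, 0; 0, b 1] * triXr

/-- The residual scatter matrix `(Y - B X)(Y - B X)ᵀ`. -/
noncomputable def triScatter (b : Fin 2 → ℝ) : Matrix (Fin 2) (Fin 2) ℝ :=
  triResid b * (triResid b)ᵀ

theorem triScatter_eq (b : Fin 2 → ℝ) : triScatter b =
    !![(186466 - 165834 * b 0 + 50854 * b 0 ^ 2) / 10 ^ 4,
        (537860 - 228581 * b 0 - 215446 * b 1 + 101658 * b 0 * b 1) / 10 ^ 4;
      (537860 - 228581 * b 0 - 215446 * b 1 + 101658 * b 0 * b 1) / 10 ^ 4,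
        (1564082 - 1233052 * b 1 + 252333 * b 1 ^ 2) / 10 ^ 4] := by
  ext i j
  simp only [triScatter, triResid, Matrix.mul_apply, Matrix.sub_apply, transpose_apply,
    Fin.sum_univ_five, Fin.sum_univ_two]
  fin_cases i <;> fin_cases j <;> simp [triYr, triXr] <;> ring

/-- Four of the maximal minors of the residual matrix have no common zero. -/
theorem triResid_vecMul_injective (b : Fin 2 → ℝ) : Function.Injective (triResid b).vecMul := by
  refine (injective_iff_map_eq_zero (triResid b).vecMulLinear).2 fun v hv => ?_
  have h (j : Fin 5) : v 0 * triResid b 0 j + v 1 * triResid b 1 j = 0 := by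
    simpa [vecMul, dotProduct, Fin.sum_univ_two] using congrFun hv j
  simp only [triResid, Matrix.sub_apply, Matrix.mul_apply, Fin.sum_univ_two, triYr, triXr] at h
  have h₀ := h 0
  have h₁ := h 1
  have h₂ := h 2
  have h₃ := h 3
  have h₄ := h 4
  simp at h₀ h₁ h₂ h₃ h₄
  ext i
  fin_cases i
  · change v 0 = 0
    linear_combination (10 ^ 4 / 1178360368704 : ℝ) *
      (3769689473 * (h₀ * (-1.93 + b 1 * 1.18) - h₁ * (0.52 + b 1 * 0.04))
        + 5035266657 * (h₀ * (-6.67 + b 1 * 2.42) - h₃ * (0.52 + b 1 * 0.04))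
        - 4321644292 * (h₀ * (-9.94 + b 1 * 3.75) - h₄ * (0.52 + b 1 * 0.04))
        + 47263320 * (h₂ * (-9.94 + b 1 * 3.75) - h₄ * (3.02 - b 1 * 1.98)))
  · change v 1 = 0
    linear_combination (-10 ^ 4 / 1178360368704 : ℝ) *
      (3769689473 * (h₀ * (-0.73 + b 0 * 0.80) - h₁ * (0.14 + b 0 * 0.65))
        + 5035266657 * (h₀ * (-2.29 + b 0 * 1.03) - h₃ * (0.14 + b 0 * 0.65))
        - 4321644292 * (h₀ * (-3.30 + b 0 * 1.08) - h₄ * (0.14 + b 0 * 0.65))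
        + 47263320 * (h₂ * (-3.30 + b 0 * 1.08) - h₄ * (1.40 - b 0 * 1.34)))

theorem triScatter_posDef (b : Fin 2 → ℝ) : (triScatter b).PosDef := by
  have := PosDef.mul_conjTranspose_self (triResid b) (triResid_vecMul_injective b)
  rwa [conjTranspose_eq_transpose_of_trivial] at this

theorem triLogLik_eq (p : (Fin 2 → ℝ) × Matrix (Fin 2) (Fin 2) ℝ) : triLogLik p =
    -(2 * 5 / 2 : ℝ) * Real.log (2 * Real.pi)
      - (5 / 2 : ℝ) * Real.log (p.2 0 0 * p.2 1 1 - p.2 0 1 * p.2 1 0)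
      - (1 / 2 : ℝ) * ((p.2 1 1 * triScatter p.1 0 0 - p.2 0 1 * triScatter p.1 0 1
        - p.2 1 0 * triScatter p.1 0 1 + p.2 0 0 * triScatter p.1 1 1)
          / (p.2 0 0 * p.2 1 1 - p.2 0 1 * p.2 1 0)) := by
  have h : triScatter p.1 1 0 = triScatter p.1 0 1 := by simp [triScatter_eq]
  change -(2 * 5 / 2 : ℝ) * Real.log (2 * Real.pi) - (5 / 2 : ℝ) * Real.log p.2.det
    - (1 / 2 : ℝ) * (p.2⁻¹ * triScatter p.1).trace = _
  rw [inv_def, adjugate_fin_two, det_fin_two, Ring.inverse_eq_inv', smul_mul, trace_smul,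
    trace_fin_two]
  simp only [Matrix.mul_apply, Fin.sum_univ_two, h]
  simp
  ring

theorem differentiableAt_triLogLik {p : (Fin 2 → ℝ) × Matrix (Fin 2) (Fin 2) ℝ}
    (hp : p.2.det ≠ 0) : DifferentiableAt ℝ triLogLik p := by
  rw [det_fin_two] at hp
  have hf (i j : Fin 2) : DifferentiableAt ℝ
      (fun q : (Fin 2 → ℝ) × Matrix (Fin 2) (Fin 2) ℝ => q.2 i j) p :=
    (differentiableAt_pi.1 (differentiableAt_pi.1 differentiableAt_snd i) j)
  have hb (i : Fin 2) : DifferentiableAt ℝ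
      (fun q : (Fin 2 → ℝ) × Matrix (Fin 2) (Fin 2) ℝ => q.1 i) p := by fun_prop
  rw [funext triLogLik_eq]
  simp only [triScatter_eq]
  simp
  fun_prop (disch := assumption)

theorem hasDerivAt_quadratic_zero (a b c : ℝ) :
    HasDerivAt (fun t : ℝ => a + b * t + c * t ^ 2) b 0 := by
  refine ((((hasDerivAt_id (0 : ℝ)).const_mul b).const_add a).add
    (((hasDerivAt_id (0 : ℝ)).pow 2).const_mul c)).congr_deriv ?_
  simp

theorem hasDerivAt_triScatter_zero_zero (b u : Fin 2 → ℝ) :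
    HasDerivAt (fun t : ℝ => triScatter (b + t • u) 0 0)
      ((101708 * b 0 - 165834) * u 0 / 10 ^ 4) 0 := by
  convert hasDerivAt_quadratic_zero (triScatter b 0 0) _ (50854 * u 0 ^ 2 / 10 ^ 4) using 2
  simp [triScatter_eq]
  ring

theorem hasDerivAt_triScatter_zero_one (b u : Fin 2 → ℝ) :
    HasDerivAt (fun t : ℝ => triScatter (b + t • u) 0 1)
      (((101658 * b 1 - 228581) * u 0 + (101658 * b 0 - 215446) * u 1) / 10 ^ 4) 0 := by
  convert hasDerivAt_quadratic_zero (triScatter b 0 1) _ (101658 * u 0 * u 1 / 10 ^ 4) using 2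
  simp [triScatter_eq]
  ring

theorem hasDerivAt_triScatter_one_one (b u : Fin 2 → ℝ) :
    HasDerivAt (fun t : ℝ => triScatter (b + t • u) 1 1)
      ((504666 * b 1 - 1233052) * u 1 / 10 ^ 4) 0 := by
  convert hasDerivAt_quadratic_zero (triScatter b 1 1) _ (252333 * u 1 ^ 2 / 10 ^ 4) using 2
  simp [triScatter_eq]
  ring

theorem hasLineDerivAt_triLogLik {p : (Fin 2 → ℝ) × Matrix (Fin 2) (Fin 2) ℝ}
    (v : (Fin 2 → ℝ) × Matrix (Fin 2) (Fin 2) ℝ) {d N d' N' : ℝ} (hd : d ≠ 0)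
    (hdp : d = p.2 0 0 * p.2 1 1 - p.2 0 1 * p.2 1 0)
    (hNp : N = p.2 1 1 * triScatter p.1 0 0 - p.2 0 1 * triScatter p.1 0 1
        - p.2 1 0 * triScatter p.1 0 1 + p.2 0 0 * triScatter p.1 1 1)
    (hd' : d' = v.2 0 0 * p.2 1 1 + p.2 0 0 * v.2 1 1 - v.2 0 1 * p.2 1 0 - p.2 0 1 * v.2 1 0)
    (hN' : N' = v.2 1 1 * triScatter p.1 0 0 - (v.2 0 1 + v.2 1 0) * triScatter p.1 0 1
        + v.2 0 0 * triScatter p.1 1 1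
      + (p.2 1 1 * ((101708 * p.1 0 - 165834) * v.1 0)
        - (p.2 0 1 + p.2 1 0) * ((101658 * p.1 1 - 228581) * v.1 0
          + (101658 * p.1 0 - 215446) * v.1 1)
        + p.2 0 0 * ((504666 * p.1 1 - 1233052) * v.1 1)) / 10 ^ 4) :
    HasLineDerivAt ℝ triLogLik
      (-(5 / 2) * (d' / d) - 1 / 2 * ((N' * d - N * d') / d ^ 2)) p v := by
  have hm (i j : Fin 2) : HasDerivAt (fun t : ℝ => (p.2 + t • v.2) i j) (v.2 i j) 0 := by
    convert hasDerivAt_quadratic_zero (p.2 i j) (v.2 i j) 0 using 2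
    simp [mul_comm]
  have hD : HasDerivAt (fun t : ℝ => (p.2 + t • v.2) 0 0 * (p.2 + t • v.2) 1 1
      - (p.2 + t • v.2) 0 1 * (p.2 + t • v.2) 1 0) d' 0 := by
    refine (((hm 0 0).mul (hm 1 1)).sub ((hm 0 1).mul (hm 1 0))).congr_deriv ?_
    simp [hd']
    ring
  have h₁₂ := hasDerivAt_triScatter_zero_one p.1 v.1
  have hN : HasDerivAt (fun t : ℝ => (p.2 + t • v.2) 1 1 * triScatter (p.1 + t • v.1) 0 0
      - (p.2 + t • v.2) 0 1 * triScatter (p.1 + t • v.1) 0 1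
      - (p.2 + t • v.2) 1 0 * triScatter (p.1 + t • v.1) 0 1
      + (p.2 + t • v.2) 0 0 * triScatter (p.1 + t • v.1) 1 1) N' 0 := by
    refine (((((hm 1 1).mul (hasDerivAt_triScatter_zero_zero p.1 v.1)).sub ((hm 0 1).mul h₁₂)).sub
      ((hm 1 0).mul h₁₂)).add
        ((hm 0 0).mul (hasDerivAt_triScatter_one_one p.1 v.1))).congr_deriv ?_
    simp only [zero_smul, add_zero, hN']
    ring
  have hd₀ : (p.2 + (0 : ℝ) • v.2) 0 0 * (p.2 + (0 : ℝ) • v.2) 1 1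
      - (p.2 + (0 : ℝ) • v.2) 0 1 * (p.2 + (0 : ℝ) • v.2) 1 0 ≠ 0 := by simpa [← hdp] using hd
  rw [HasLineDerivAt, funext triLogLik_eq]
  refine (((((hD.log hd₀).const_mul (5 / 2)).const_sub
    (-(2 * 5 / 2 : ℝ) * Real.log (2 * Real.pi))).sub
      ((hN.div hD hd₀).const_mul (1 / 2)))).congr_deriv ?_
  simp only [zero_smul, add_zero, ← hdp, ← hNp]
  ring

theorem fderiv_triLogLik_eq_zero_iff {p : (Fin 2 → ℝ) × Matrix (Fin 2) (Fin 2) ℝ}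
    (hp : p.2.PosDef) : fderiv ℝ triLogLik p = 0 ↔
      (triQuad (p.1 1) * p.1 0 + triLin (p.1 1) = 0 ∧ triPartial (p.1 0) (p.1 1) = 0) ∧
        p.2 = (1 / 5 : ℝ) • triScatter p.1 := by
  have hdet : p.2.det ≠ 0 := hp.det_pos.ne'
  have hsymm : p.2 1 0 = p.2 0 1 := by simpa using hp.isHermitian.apply 0 1
  have hS : triScatter p.1 1 0 = triScatter p.1 0 1 := by simp [triScatter_eq]
  have hlin := (differentiableAt_triLogLik hdet).hasFDerivAt.hasLineDerivAt
  rw [det_fin_two] at hdet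
  obtain ⟨d, hd⟩ : ∃ d, d = p.2 0 0 * p.2 1 1 - p.2 0 1 * p.2 1 0 := ⟨_, rfl⟩
  obtain ⟨N, hN⟩ : ∃ N, N = p.2 1 1 * triScatter p.1 0 0 - p.2 0 1 * triScatter p.1 0 1
        - p.2 1 0 * triScatter p.1 0 1 + p.2 0 0 * triScatter p.1 1 1 := ⟨_, rfl⟩
  rw [← hd] at hdet
  have hder (v) := (hlin v).unique (hasLineDerivAt_triLogLik v hdet hd hN rfl rfl)
  rw [hsymm] at hd hN hder
  constructor
  · intro h
    have hzero {d' N' : ℝ} (h : 0 = -(5 / 2) * (d' / d) - 1 / 2 * ((N' * d - N * d') / d ^ 2)) :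
        5 * d * d' + N' * d - N * d' = 0 := by
      field_simp at h
      linarith
    simp only [h] at hder
    have e₀₀ := hzero (hder (0, !![1, 0; 0, 0]))
    have e₀₁ := hzero (hder (0, !![0, 1; 0, 0]))
    have e₁₁ := hzero (hder (0, !![0, 0; 0, 1]))
    have u₀ := hzero (hder (![1, 0], 0))
    have u₁ := hzero (hder (![0, 1], 0))
    simp at e₀₀ e₀₁ e₁₁ u₀ u₁
    have hN10 : N = 10 * d := by
      apply mul_left_cancel₀ hdet
      linear_combination -p.2 1 1 * e₁₁ - p.2 0 0 * e₀₀ - 2 * p.2 0 1 * e₀₁ - d * hN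
        - (10 * d - 2 * N) * hd
    subst hN10
    have hM {m s : ℝ} (h : d * (s - 5 * m) = 0) : m = 1 / 5 * s := by
      have := (mul_eq_zero.1 h).resolve_left hdet
      linarith
    have s₀₀ : p.2 0 0 = 1 / 5 * triScatter p.1 0 0 := hM (by linear_combination e₁₁)
    have s₁₁ : p.2 1 1 = 1 / 5 * triScatter p.1 1 1 := hM (by linear_combination e₀₀)
    have s₀₁ : p.2 0 1 = 1 / 5 * triScatter p.1 0 1 := hM (by linear_combination -e₀₁)
    replace u₀ := u₀.resolve_right hdet
    replace u₁ := u₁.resolve_right hdet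
    simp only [s₀₀, s₁₁, s₀₁] at u₀ u₁
    simp [triScatter_eq] at u₀ u₁
    refine ⟨⟨?_, ?_⟩, ?_⟩
    · unfold triQuad triLin
      linear_combination (5 * 10 ^ 4 / 2) * u₀
    · unfold triPartial
      linear_combination (5 * 10 ^ 4 / 2) * u₁
    · ext i j
      fin_cases i <;> fin_cases j <;> simp [s₀₀, s₀₁, s₁₁, hsymm, hS]
  · rintro ⟨⟨h₁, h₂⟩, h₃⟩
    have s₀₀ : p.2 0 0 = 1 / 5 * triScatter p.1 0 0 := congrFun (congrFun h₃ 0) 0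
    have s₁₁ : p.2 1 1 = 1 / 5 * triScatter p.1 1 1 := congrFun (congrFun h₃ 1) 1
    have s₀₁ : p.2 0 1 = 1 / 5 * triScatter p.1 0 1 := congrFun (congrFun h₃ 0) 1
    have hN10 : N = 10 * d := by
      rw [hN, hd, s₀₀, s₁₁, s₀₁]
      ring
    refine ContinuousLinearMap.ext fun v => (hder v).trans ?_
    have hzero {d' N' : ℝ} (h : N' = 5 * d') :
        -(5 / 2) * (d' / d) - 1 / 2 * ((N' * d - N * d') / d ^ 2) = 0 := by
      rw [h, hN10]
      field_simp
      ring
    apply hzero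
    simp only [s₀₀, s₁₁, s₀₁]
    simp [triScatter_eq]
    unfold triQuad triLin at h₁
    unfold triPartial at h₂
    linear_combination (2 / (5 * 10 ^ 8)) * (v.1 0 * h₁ + v.1 1 * h₂)

/-- For the data (13), the system ∂G/∂β₁ = ∂G/∂β₂ = 0 has exactly five
complex solutions, all of which are real: the variety of the maximum likelihood ideal
is purely real with five points, so the likelihood function of the SUR model with
C_R = {(1,1),(2,2)} has exactly five stationary points. -/
theorem tri_critical_points_purely_real :
    triCrit.Finite ∧ triCrit.ncard = 5
    ∧ (∀ z ∈ triCrit, ∀ i, (z i).im = 0)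
    ∧ {p : (Fin 2 → ℝ) × Matrix (Fin 2) (Fin 2) ℝ |
        p.2.PosDef ∧ fderiv ℝ triLogLik p = 0}.ncard = 5 := by
  obtain ⟨r, hr, hroot⟩ := exists_triElim_roots
  let b (i : Fin 5) : Fin 2 → ℝ := ![-triLin (r i) / triQuad (r i), r i]
  have hb : Function.Injective b := fun i j hij => hr (congrFun hij 1)
  have hcast (i) : (fun k => (b i k : ℂ)) = ![-triLin (r i : ℂ) / triQuad (r i : ℂ), (r i : ℂ)] := by
    ext k
    fin_cases k <;> simp [b, ofReal_triLin, ofReal_triQuad]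
  have hcrit : triCrit = Set.range fun i k => (b i k : ℂ) := by
    rw [triCrit_eq]
    ext z
    have hz : triElim (z 1) = 0 → triQuad (z 1) ≠ 0 := by
      intro h
      obtain ⟨i, hi⟩ := (hroot _).1 h
      rw [← hi, ← ofReal_triQuad]
      exact_mod_cast (triQuad_pos (r i)).ne'
    rw [Set.mem_ofPred_eq, tri_critical_equations_iff hz, hroot]
    simp only [Set.mem_range, hcast]
    constructor
    · rintro ⟨⟨i, hi⟩, h⟩
      refine ⟨i, ?_⟩
      ext k
      fin_cases k <;> simp [hi, h]
    · rintro ⟨i, rfl⟩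
      exact ⟨⟨i, rfl⟩, rfl⟩
  have hreal : {p : (Fin 2 → ℝ) × Matrix (Fin 2) (Fin 2) ℝ |
      p.2.PosDef ∧ fderiv ℝ triLogLik p = 0} =
        Set.range fun i => (b i, (1 / 5 : ℝ) • triScatter (b i)) := by
    ext p
    rw [Set.mem_ofPred_eq, and_congr_right fderiv_triLogLik_eq_zero_iff,
      tri_critical_equations_iff fun _ => (triQuad_pos _).ne']
    constructor
    · rintro ⟨-, ⟨h₁, h₂⟩, h₃⟩
      obtain ⟨i, hi⟩ := (hroot (p.1 1)).1 (by rw [← ofReal_triElim, h₁, Complex.ofReal_zero])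
      rw [Complex.ofReal_inj] at hi
      have hp : b i = p.1 := by
        ext k
        fin_cases k <;> simp [b, hi, h₂]
      exact ⟨i, Prod.ext hp (by rw [h₃, ← hp])⟩
    · rintro ⟨i, rfl⟩
      refine ⟨(triScatter_posDef (b i)).smul (by norm_num), ⟨?_, rfl⟩, rfl⟩
      have h := (hroot (r i)).2 ⟨i, rfl⟩
      rw [← ofReal_triElim] at h
      exact_mod_cast h
  have hinj : Function.Injective fun i k => (b i k : ℂ) := fun i j hij =>
    hb (funext fun k => Complex.ofReal_injective (congrFun hij k))
  have hinj' : Function.Injective fun i => (b i, (1 / 5 : ℝ) • triScatter (b i)) := fun i j hij =>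
    hb (congrArg Prod.fst hij)
  rw [hreal, hcrit]
  refine ⟨Set.finite_range _, ?_, ?_, ?_⟩
  · rw [Set.ncard_range_of_injective hinj, Nat.card_fin]
  · rintro _ ⟨i, rfl⟩ k
    exact Complex.ofReal_im _
  · rw [Set.ncard_range_of_injective hinj', Nat.card_fin]
end
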